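/- arXiv:1907.04547 — 5 statements merged into one kernel-verified Lean document; each statement's English description precedes it below -/
import Mathlib

section
/- Let N ≥ 2 be an integer and ξ ∈ (0, 1/2), and let m: ℕ → [0,∞) be the cut-off weight function defined by m(k) = √(k/N) if k ≥ N^{1−2ξ} and m(k) = (N^{−1+ξ} k + N^{−ξ})/2 if k < N^{1−2ξ}. Then for every k ∈ ℕ one has 0 ≤ m(k+1) − m(k) ≤ (1/2) N^{−1+ξ}, and consequently 0 ≤ m(k+2) − m(k) ≤ N^{−1+ξ}. -/
/-- The cut-off weight function `m` of Definition 3.3: `m(k) = √(k/N)` for `k ≥ N^{1-2ξ}`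
and `m(k) = (N^{-1+ξ} k + N^{-ξ})/2` otherwise. -/
noncomputable def cutoffWeight (N : ℕ) (ξ : ℝ) (k : ℕ) : ℝ :=
  if (N : ℝ) ^ (1 - 2 * ξ) ≤ (k : ℝ) then Real.sqrt ((k : ℝ) / (N : ℝ))
  else ((N : ℝ) ^ (-1 + ξ) * (k : ℝ) + (N : ℝ) ^ (-ξ)) / 2

theorem cutoffWeight_succ_sub_bounds (N : ℕ) (hN : 0 < N) (ξ : ℝ) (k : ℕ) :
    0 ≤ cutoffWeight N ξ (k + 1) - cutoffWeight N ξ k ∧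
      cutoffWeight N ξ (k + 1) - cutoffWeight N ξ k ≤ (1 / 2) * (N : ℝ) ^ (-1 + ξ) := by
  have hN' : (0 : ℝ) < N := by exact_mod_cast hN
  have ha : 0 < (N : ℝ) ^ (-1 + ξ) := Real.rpow_pos_of_pos hN' _
  have hb : 0 < (N : ℝ) ^ (-ξ) := Real.rpow_pos_of_pos hN' _
  have hab : (N : ℝ) ^ (-1 + ξ) * (N : ℝ) ^ (-ξ) = (N : ℝ)⁻¹ := by
    rw [← Real.rpow_add hN', ← Real.rpow_neg_one]
    ring_nf
  have hT : (N : ℝ) ^ (-1 + ξ) * (N : ℝ) ^ (1 - 2 * ξ) = (N : ℝ) ^ (-ξ) := by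
    rw [← Real.rpow_add hN']
    ring_nf
  unfold cutoffWeight
  push_cast
  generalize (N : ℝ) ^ (-1 + ξ) = a at *
  generalize (N : ℝ) ^ (-ξ) = b at *
  generalize (N : ℝ) ^ (1 - 2 * ξ) = T at *
  have hk : (0 : ℝ) ≤ k := k.cast_nonneg
  generalize (k : ℝ) = x at *
  have hs : √(x / N) ^ 2 = a * b * x := by
    rw [Real.sq_sqrt (by positivity), hab]
    ring
  have hs' : √((x + 1) / N) ^ 2 = a * b * (x + 1) := by
    rw [Real.sq_sqrt (by positivity), hab]
    ring
  have hs0 := Real.sqrt_nonneg (x / N)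
  have hs0' := Real.sqrt_nonneg ((x + 1) / N)
  generalize √(x / N) = s at *
  generalize √((x + 1) / N) = t at *
  have hab0 : 0 < a * b := mul_pos ha hb
  split_ifs with h₁ h₂ h₂
  · have hbs : b ≤ s := by
      have := mul_le_mul_of_nonneg_left h₂ ha.le
      refine (pow_le_pow_iff_left₀ (by positivity) (by positivity) two_ne_zero).1 ?_
      nlinarith
    have hst : s ≤ t := by
      refine (pow_le_pow_iff_left₀ (by positivity) (by positivity) two_ne_zero).1 ?_
      nlinarith
    refine ⟨by linarith, ?_⟩
    have h : (t - s) * (t + s) = a * b := by linarith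
    have : (t - s) * (2 * b) ≤ a * b :=
      h ▸ mul_le_mul_of_nonneg_left (by linarith) (by linarith)
    nlinarith
  · have hbt : b ≤ t := by
      have := mul_le_mul_of_nonneg_left h₁ ha.le
      refine (pow_le_pow_iff_left₀ (by positivity) (by positivity) two_ne_zero).1 ?_
      nlinarith
    have hx := mul_le_mul_of_nonneg_left (not_le.1 h₂).le ha.le
    refine ⟨by linarith, ?_⟩
    have : t * b ≤ (a * (x + 1) + b) / 2 * b := by nlinarith [sq_nonneg (t - b)]
    have := le_of_mul_le_mul_right this hb
    linarith
  · linarith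
  · constructor <;> linarith

theorem stmt3 (N : ℕ) (hN : 2 ≤ N) (ξ : ℝ) (hξ : ξ ∈ Set.Ioo (0 : ℝ) (1 / 2)) (k : ℕ) :
    (0 ≤ cutoffWeight N ξ (k + 1) - cutoffWeight N ξ k ∧
        cutoffWeight N ξ (k + 1) - cutoffWeight N ξ k ≤ (1 / 2) * (N : ℝ) ^ (-1 + ξ)) ∧
      (0 ≤ cutoffWeight N ξ (k + 2) - cutoffWeight N ξ k ∧
        cutoffWeight N ξ (k + 2) - cutoffWeight N ξ k ≤ (N : ℝ) ^ (-1 + ξ)) := by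
  have h₀ := cutoffWeight_succ_sub_bounds N (by omega) ξ k
  have h₁ := cutoffWeight_succ_sub_bounds N (by omega) ξ (k + 1)
  rw [show k + 1 + 1 = k + 2 from rfl] at h₁
  exact ⟨h₀, by linarith, by linarith⟩
end

section
/- There is an absolute constant C > 0 (independent of N, ξ, and k) with the following property: for every integer N ≥ 2, every ξ ∈ (0, 1/2), and every k ∈ ℕ, the weight m satisfies |m(k) − 2m(k+1) + m(k+2)| ≤ C N^{−2+3ξ}, |m(k) − m(k+1) − m(k+2) + m(k+3)| ≤ C N^{−2+3ξ}, and |m(k) − 2m(k+2) + m(k+4)| ≤ C N^{−2+3ξ}. -/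
/-- The square root, continued to the left of `a ^ 2` by its tangent line at `a ^ 2`. -/
noncomputable def tangentSqrt (a x : ℝ) : ℝ :=
  if a ^ 2 ≤ x then √x else (x / a + a) / 2

theorem sub_tangentSqrt_nonneg {a : ℝ} (ha : 0 < a) (x : ℝ) :
    0 ≤ (x / a + a) / 2 - tangentSqrt a x := by
  unfold tangentSqrt
  split_ifs with h
  · have hx : √x ^ 2 = x := Real.sq_sqrt ((sq_nonneg a).trans h)
    have : (x / a + a) / 2 - √x = (√x - a) ^ 2 / (2 * a) := by
      field_simp
      linear_combination -hx
    rw [this]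
    positivity
  · simp

theorem sub_tangentSqrt_le {a x t : ℝ} (ha : 0 < a) (hx : x ≤ a ^ 2 + t) :
    (x / a + a) / 2 - tangentSqrt a x ≤ t ^ 2 / 8 * a⁻¹ ^ 3 := by
  unfold tangentSqrt
  split_ifs with h
  · have hs : √x ^ 2 = x := Real.sq_sqrt ((sq_nonneg a).trans h)
    have hle : a ≤ √x := Real.le_sqrt_of_sq_le h
    have hd : (√x - a) * (2 * a) ≤ t := by nlinarith
    have hd2 : ((√x - a) * (2 * a)) ^ 2 ≤ t ^ 2 :=
      pow_le_pow_left₀ (mul_nonneg (sub_nonneg.2 hle) (by positivity)) hd 2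
    have : (x / a + a) / 2 - √x = ((√x - a) * (2 * a)) ^ 2 / 8 * a⁻¹ ^ 3 := by
      field_simp
      linear_combination -8 * hs
    rw [this]
    gcongr
  · simp only [sub_self]
    positivity

theorem abs_sqrt_second_difference_le {a x : ℝ} (ha : 0 < a) (h : a ^ 2 ≤ x) :
    |√x - 2 * √(x + 1) + √(x + 2)| ≤ 1 / 4 * a⁻¹ ^ 3 := by
  have hx : 0 ≤ x := (sq_nonneg a).trans h
  have hp : a ≤ √x := Real.le_sqrt_of_sq_le h
  have hq : a ≤ √(x + 1) := Real.le_sqrt_of_sq_le (by linarith)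
  have hr : a ≤ √(x + 2) := Real.le_sqrt_of_sq_le (by linarith)
  have hp2 : √x ^ 2 = x := Real.sq_sqrt hx
  have hq2 : √(x + 1) ^ 2 = x + 1 := Real.sq_sqrt (by linarith)
  have hr2 : √(x + 2) ^ 2 = x + 2 := Real.sq_sqrt (by linarith)
  generalize √x = p at *
  generalize √(x + 1) = q at *
  generalize √(x + 2) = r at *
  have hp0 : 0 < p := ha.trans_le hp
  have hq0 : 0 < q := ha.trans_le hq
  have hr0 : 0 < r := ha.trans_le hr
  have hqp : q - p = 1 / (q + p) := by
    field_simp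
    linear_combination hq2 - hp2
  have hrq : r - q = 1 / (r + q) := by
    field_simp
    linear_combination hr2 - hq2
  have hrp : r - p = 2 / (r + p) := by
    field_simp
    linear_combination hr2 - hp2
  have key : p - 2 * q + r = -(2 / ((r + p) * (r + q) * (q + p))) := by
    have h1 : p - 2 * q + r = 1 / (r + q) - 1 / (q + p) := by
      rw [← hqp, ← hrq]
      ring
    have h2 : 1 / (r + q) - 1 / (q + p) = -((r - p) / ((r + q) * (q + p))) := by
      field_simp
      ring
    rw [h1, h2, hrp]
    field_simp
  rw [key, abs_neg, abs_of_nonneg (by positivity)]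
  calc 2 / ((r + p) * (r + q) * (q + p))
      ≤ 2 / ((a + a) * (a + a) * (a + a)) := by gcongr
    _ = 1 / 4 * a⁻¹ ^ 3 := by
      field_simp
      norm_num

theorem abs_tangentSqrt_second_difference_le {a : ℝ} (ha : 0 < a) (x : ℝ) :
    |tangentSqrt a x - 2 * tangentSqrt a (x + 1) + tangentSqrt a (x + 2)| ≤
      1 / 2 * a⁻¹ ^ 3 := by
  have hpos : 0 < a⁻¹ ^ 3 := by positivity
  by_cases h : a ^ 2 ≤ x
  · have := abs_sqrt_second_difference_le ha h
    simp only [tangentSqrt, if_pos h, if_pos (show a ^ 2 ≤ x + 1 by linarith),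
      if_pos (show a ^ 2 ≤ x + 2 by linarith)]
    linarith
  · have h0 : tangentSqrt a x = (x / a + a) / 2 := if_neg h
    have h1 := sub_tangentSqrt_nonneg ha (x + 1)
    have h2 := sub_tangentSqrt_nonneg ha (x + 2)
    have h1' := sub_tangentSqrt_le (x := x + 1) (t := 1) ha (by linarith)
    have h2' := sub_tangentSqrt_le (x := x + 2) (t := 2) ha (by linarith)
    have h21 : 2 / a = 2 * (1 / a) := by ring
    simp only [add_div, h21] at h0 h1 h2 h1' h2'
    rw [abs_le]
    constructor <;> linarith

theorem cutoffWeight_eq_tangentSqrt {N : ℕ} (hN : 0 < N) (ξ : ℝ) (k : ℕ) :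
    cutoffWeight N ξ k =
      (N : ℝ) ^ (-1 / 2 : ℝ) * tangentSqrt ((N : ℝ) ^ (1 / 2 - ξ)) k := by
  have hN' : (0 : ℝ) < N := by exact_mod_cast hN
  have hsq : ((N : ℝ) ^ (1 / 2 - ξ)) ^ 2 = (N : ℝ) ^ (1 - 2 * ξ) := by
    rw [← Real.rpow_natCast, ← Real.rpow_mul hN'.le]
    congr 1
    push_cast
    ring
  unfold cutoffWeight tangentSqrt
  rw [hsq]
  split_ifs
  · rw [Real.sqrt_div' _ hN'.le, Real.sqrt_eq_rpow (N : ℝ), neg_div, Real.rpow_neg hN'.le]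
    ring
  · have h1 : (N : ℝ) ^ (-1 + ξ) = (N : ℝ) ^ (-1 / 2 : ℝ) / (N : ℝ) ^ (1 / 2 - ξ) := by
      rw [← Real.rpow_sub hN']
      congr 1
      ring
    have h2 : (N : ℝ) ^ (-ξ) = (N : ℝ) ^ (-1 / 2 : ℝ) * (N : ℝ) ^ (1 / 2 - ξ) := by
      rw [← Real.rpow_add hN']
      congr 1
      ring
    rw [h1, h2]
    ring

theorem abs_cutoffWeight_second_difference_le {N : ℕ} (hN : 0 < N) (ξ : ℝ) (k : ℕ) :
    |cutoffWeight N ξ k - 2 * cutoffWeight N ξ (k + 1) + cutoffWeight N ξ (k + 2)| ≤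
      1 / 2 * (N : ℝ) ^ (-2 + 3 * ξ) := by
  have hN' : (0 : ℝ) < N := by exact_mod_cast hN
  have hpow : (N : ℝ) ^ (-2 + 3 * ξ) =
      (N : ℝ) ^ (-1 / 2 : ℝ) * ((N : ℝ) ^ (1 / 2 - ξ))⁻¹ ^ 3 := by
    rw [← Real.rpow_neg hN'.le, ← Real.rpow_natCast, ← Real.rpow_mul hN'.le,
      ← Real.rpow_add hN']
    congr 1
    push_cast
    ring
  have h := abs_tangentSqrt_second_difference_le (Real.rpow_pos_of_pos hN' (1 / 2 - ξ)) k
  simp only [cutoffWeight_eq_tangentSqrt hN, hpow]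
  push_cast
  rw [mul_left_comm 2, ← mul_sub, ← mul_add, abs_mul,
    abs_of_pos (Real.rpow_pos_of_pos hN' _), mul_left_comm (1 / 2)]
  gcongr

theorem stmt4 :
    ∃ C > (0 : ℝ), ∀ (N : ℕ), 2 ≤ N → ∀ ξ ∈ Set.Ioo (0 : ℝ) (1 / 2), ∀ k : ℕ,
      |cutoffWeight N ξ k - 2 * cutoffWeight N ξ (k + 1) + cutoffWeight N ξ (k + 2)| ≤
          C * (N : ℝ) ^ (-2 + 3 * ξ) ∧
        |cutoffWeight N ξ k - cutoffWeight N ξ (k + 1) - cutoffWeight N ξ (k + 2) +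
              cutoffWeight N ξ (k + 3)| ≤ C * (N : ℝ) ^ (-2 + 3 * ξ) ∧
          |cutoffWeight N ξ k - 2 * cutoffWeight N ξ (k + 2) + cutoffWeight N ξ (k + 4)| ≤
            C * (N : ℝ) ^ (-2 + 3 * ξ) := by
  refine ⟨2, two_pos, fun N hN ξ _ k => ?_⟩
  have hN0 : 0 < N := by omega
  have h0 := abs_le.1 (abs_cutoffWeight_second_difference_le hN0 ξ k)
  have h1 := abs_le.1 (abs_cutoffWeight_second_difference_le hN0 ξ (k + 1))
  have h2 := abs_le.1 (abs_cutoffWeight_second_difference_le hN0 ξ (k + 2))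
  simp only [add_assoc, Nat.reduceAdd] at h0 h1 h2
  have hpos : 0 ≤ (N : ℝ) ^ (-2 + 3 * ξ) := by positivity
  refine ⟨abs_le.2 ⟨?_, ?_⟩, abs_le.2 ⟨?_, ?_⟩, abs_le.2 ⟨?_, ?_⟩⟩ <;> linarith
end

section
/- Let N be a positive integer, ℳ ⊆ {1,…,N} nonempty, j ∉ ℳ, and k, l ∈ ℳ with k ≠ l. Let Γ, Λ ∈ L²(ℝ^{3N}) both be invariant under every permutation of the coordinates indexed by ℳ, and let F: ℝ³ × ℝ³ → ℂ be a bounded measurable function. Writing F(z_j, z_m) for the multiplication operator by (z_1,…,z_N) ↦ F(z_j, z_m), one has |⟨Γ, F(z_j, z_k) Λ⟩| ≤ ‖Γ‖ ( |⟨F(z_j, z_k) Λ, F(z_j, z_l) Λ⟩| + |ℳ|^{−1} ‖F(z_j, z_k) Λ‖² )^{1/2}. -/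
open MeasureTheory

/-- One-particle configuration space `ℝ³ ≅ ℝ²ₓ × ℝ_y`. -/
abbrev Z3 : Type := EuclideanSpace ℝ (Fin 2) × ℝ

/-- Cauchy-Schwarz after averaging over a family whose Gram matrix is constant on and off
the diagonal. -/
theorem norm_inner_le_of_exchangeable {ι E : Type*} [DecidableEq ι] [NormedAddCommGroup E]
    [InnerProductSpace ℂ E] (S : Finset ι) (g : E) (G : ι → E) (k l : ι) (hk : k ∈ S)
    (h1 : ∀ m ∈ S, inner ℂ g (G m) = inner ℂ g (G k))
    (h2 : ∀ m ∈ S, inner ℂ (G m) (G m) = inner ℂ (G k) (G k))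
    (h3 : ∀ m ∈ S, ∀ n ∈ S, m ≠ n → inner ℂ (G m) (G n) = inner ℂ (G k) (G l)) :
    ‖inner ℂ g (G k)‖ ≤
      ‖g‖ * Real.sqrt (‖inner ℂ (G k) (G l)‖ + (S.card : ℝ)⁻¹ * ‖G k‖ ^ 2) := by
  have hc : (0 : ℝ) < S.card := by exact_mod_cast Finset.card_pos.2 ⟨k, hk⟩
  have hsum : inner ℂ g (∑ m ∈ S, G m) = (S.card : ℂ) * inner ℂ g (G k) := by
    rw [inner_sum, Finset.sum_congr rfl h1, Finset.sum_const, nsmul_eq_mul]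
  have hrow : ∀ m ∈ S, ‖inner ℂ (G m) (∑ n ∈ S, G n)‖ ≤
      ‖G k‖ ^ 2 + S.card * ‖inner ℂ (G k) (G l)‖ := by
    intro m hm
    rw [inner_sum, ← Finset.add_sum_erase _ _ hm, h2 m hm]
    refine (norm_add_le _ _).trans (add_le_add ?_ ?_)
    · rw [inner_self_eq_norm_sq_to_K]
      simp
    · rw [Finset.sum_congr rfl fun n hn => h3 m hm n (Finset.mem_of_mem_erase hn)
        (Finset.ne_of_mem_erase hn).symm, Finset.sum_const, nsmul_eq_mul, norm_mul,
        Complex.norm_natCast]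
      gcongr
      exact Finset.erase_subset _ _
  have hsq : ‖∑ m ∈ S, G m‖ ^ 2 ≤
      (S.card : ℝ) ^ 2 * (‖inner ℂ (G k) (G l)‖ + (S.card : ℝ)⁻¹ * ‖G k‖ ^ 2) := by
    calc ‖∑ m ∈ S, G m‖ ^ 2 = ‖inner ℂ (∑ m ∈ S, G m) (∑ m ∈ S, G m)‖ := by
          rw [inner_self_eq_norm_sq_to_K]
          simp
      _ ≤ ∑ m ∈ S, ‖inner ℂ (G m) (∑ n ∈ S, G n)‖ := by
          rw [sum_inner]
          exact norm_sum_le _ _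
      _ ≤ S.card * (‖G k‖ ^ 2 + S.card * ‖inner ℂ (G k) (G l)‖) := by
          rw [← nsmul_eq_mul, ← Finset.sum_const]
          exact Finset.sum_le_sum hrow
      _ = _ := by
          field_simp
          ring
  have hnorm : ‖∑ m ∈ S, G m‖ ≤
      S.card * Real.sqrt (‖inner ℂ (G k) (G l)‖ + (S.card : ℝ)⁻¹ * ‖G k‖ ^ 2) := by
    have := Real.sqrt_le_sqrt hsq
    rwa [Real.sqrt_sq (norm_nonneg _), Real.sqrt_mul (sq_nonneg _), Real.sqrt_sq hc.le] at this
  have hcs := norm_inner_le_norm (𝕜 := ℂ) g (∑ m ∈ S, G m)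
  rw [hsum, norm_mul, Complex.norm_natCast] at hcs
  refine le_of_mul_le_mul_left ?_ hc
  calc _ ≤ _ := hcs
    _ ≤ _ := mul_le_mul_of_nonneg_left hnorm (norm_nonneg g)
    _ = _ := by ring

theorem coe_piCongrLeft_symm {ι α : Type*} [MeasurableSpace α] (σ : Equiv.Perm ι) :
    ⇑(MeasurableEquiv.piCongrLeft (fun _ : ι => α) σ.symm) = fun z i => z (σ i) := by
  ext z i
  simpa using MeasurableEquiv.piCongrLeft_apply_apply (β := fun _ : ι => α) σ.symm z (σ i)

/-- Integrals over a finite power are unchanged by permuting the coordinates. -/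
theorem integral_comp_perm {ι α : Type*} [Fintype ι] [MeasureSpace α]
    [SigmaFinite (volume : Measure α)] (σ : Equiv.Perm ι) (f : (ι → α) → ℂ) :
    ∫ z : ι → α, f (fun i => z (σ i)) = ∫ z, f z := by
  simpa only [coe_piCongrLeft_symm] using
    (volume_measurePreserving_piCongrLeft (fun _ : ι => α) σ.symm).integral_comp' f

theorem stmt6 (N : ℕ) (hN : 0 < N) (ℳ : Finset (Fin N)) (hℳ : ℳ.Nonempty)
    (j k l : Fin N) (hj : j ∉ ℳ) (hk : k ∈ ℳ) (hl : l ∈ ℳ) (hkl : k ≠ l)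
    (Γ Λ : Lp ℂ 2 (volume : Measure (Fin N → Z3)))
    -- `Γ` and `Λ` are invariant under all permutations of the coordinates indexed by `ℳ`:
    (hΓ : ∀ σ : Equiv.Perm (Fin N), (∀ i ∉ ℳ, σ i = i) →
      ∀ᵐ z ∂(volume : Measure (Fin N → Z3)), Γ (fun i => z (σ i)) = Γ z)
    (hΛ : ∀ σ : Equiv.Perm (Fin N), (∀ i ∉ ℳ, σ i = i) →
      ∀ᵐ z ∂(volume : Measure (Fin N → Z3)), Λ (fun i => z (σ i)) = Λ z)
    (F : Z3 → Z3 → ℂ) (hF : Measurable (Function.uncurry F))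
    (B : ℝ) (hB : ∀ a b, ‖F a b‖ ≤ B) :
    ‖∫ z : Fin N → Z3, (starRingEnd ℂ) (Γ z) * (F (z j) (z k) * Λ z)‖ ≤
      ‖Γ‖ * Real.sqrt
        (‖∫ z : Fin N → Z3,
            (starRingEnd ℂ) (F (z j) (z k) * Λ z) * (F (z j) (z l) * Λ z)‖ +
          (ℳ.card : ℝ)⁻¹ * ∫ z : Fin N → Z3, ‖F (z j) (z k) * Λ z‖ ^ 2) := by
  have hmem : ∀ m, MemLp (fun z : Fin N → Z3 => F (z j) (z m) * Λ z) 2 volume := fun m => by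
    have hFm : Measurable fun z : Fin N → Z3 => F (z j) (z m) :=
      hF.comp (f := fun z : Fin N → Z3 => (z j, z m))
        ((measurable_pi_apply j).prodMk (measurable_pi_apply m))
    refine (Lp.memLp Λ).of_le_mul (c := B) (.mul ?_ (Lp.aestronglyMeasurable Λ))
      (.of_forall fun z => ?_)
    · exact hFm.aestronglyMeasurable
    · rw [norm_mul]
      gcongr
      exact hB _ _
  let G : Fin N → Lp ℂ 2 (volume : Measure (Fin N → Z3)) := fun m => (hmem m).toLp
  have hΓG : ∀ m, inner ℂ Γ (G m) =
      ∫ z : Fin N → Z3, (starRingEnd ℂ) (Γ z) * (F (z j) (z m) * Λ z) := fun m => by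
    rw [L2.inner_def]
    refine integral_congr_ae ?_
    filter_upwards [(hmem m).coeFn_toLp] with z hz
    rw [hz, RCLike.inner_apply, mul_comm]
  have hGG : ∀ m n, inner ℂ (G m) (G n) = ∫ z : Fin N → Z3,
      (starRingEnd ℂ) (F (z j) (z m) * Λ z) * (F (z j) (z n) * Λ z) := fun m n => by
    rw [L2.inner_def]
    refine integral_congr_ae ?_
    filter_upwards [(hmem m).coeFn_toLp, (hmem n).coeFn_toLp] with z hz hz'
    rw [hz, hz', RCLike.inner_apply, mul_comm]
  have hnorm : ‖G k‖ ^ 2 = ∫ z : Fin N → Z3, ‖F (z j) (z k) * Λ z‖ ^ 2 := by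
    have h := hGG k k
    rw [inner_self_eq_norm_sq_to_K] at h
    simp only [Complex.conj_mul'] at h
    have h' := h.trans (integral_congr_ae (.of_forall fun z => (Complex.ofReal_pow _ 2).symm))
    rw [integral_complex_ofReal] at h'
    exact Complex.ofReal_injective ((Complex.ofReal_pow _ 2).trans h')
  have hswap : ∀ a ∈ ℳ, ∀ b ∈ ℳ, ∀ i ∉ ℳ, Equiv.swap a b i = i := fun a ha b hb i hi =>
    Equiv.swap_apply_of_ne_of_ne (fun h => hi (h ▸ ha)) (fun h => hi (h ▸ hb))
  have hinvΓ : ∀ σ : Equiv.Perm (Fin N), (∀ i ∉ ℳ, σ i = i) → ∀ m,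
      inner ℂ Γ (G m) = inner ℂ Γ (G (σ m)) := fun σ hσ m => by
    rw [hΓG, hΓG, ← integral_comp_perm σ]
    refine integral_congr_ae ?_
    filter_upwards [hΓ σ hσ, hΛ σ hσ] with z hz hz'
    rw [hz, hz', hσ j hj]
  have hinvG : ∀ σ : Equiv.Perm (Fin N), (∀ i ∉ ℳ, σ i = i) → ∀ m n,
      inner ℂ (G m) (G n) = inner ℂ (G (σ m)) (G (σ n)) := fun σ hσ m n => by
    rw [hGG, hGG, ← integral_comp_perm σ]
    refine integral_congr_ae ?_
    filter_upwards [hΛ σ hσ] with z hz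
    rw [hz, hσ j hj]
  rw [← hΓG, ← hGG, ← hnorm]
  refine norm_inner_le_of_exchangeable ℳ Γ G k l hk (fun m hm => ?_) (fun m hm => ?_)
    (fun m hm n hn hmn => ?_)
  · simpa using hinvΓ _ (hswap m hm k hk) m
  · simpa using hinvG _ (hswap m hm k hk) m m
  · rw [hinvG _ (hswap m hm k hk), Equiv.swap_apply_left]
    have hn' : Equiv.swap m k n ∈ ℳ := by
      rw [Equiv.swap_apply_def]
      split_ifs <;> assumption
    have hne : Equiv.swap m k n ≠ k := fun h =>
      hmn ((Equiv.swap m k).injective (by rw [h, Equiv.swap_apply_left]))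
    rw [hinvG _ (hswap _ hn' l hl), Equiv.swap_apply_left,
      Equiv.swap_apply_of_ne_of_ne hne.symm hkl]
end

section
/- Let β ∈ (0,1), c, C > 0, and μ, ε ∈ (0,1). Let w: ℝ³ → [0,∞) be measurable with ‖w‖_{L^∞(ℝ³)} ≤ C μ^{1−3β}, ∫_{ℝ³} w ≤ C μ, and support contained in {ζ : |ζ| ≤ ϱ} for some ϱ with c μ^{β} ≤ ϱ ≤ C μ^{β}; assume 2ϱ < ε. For ζ ≠ 0 set ζ* := (ε²/|ζ|²) ζ, and define h_ε: ℝ³ → ℝ by h_ε(z) = (1/4π)[ ∫_{ℝ³} w(ζ)/|z−ζ| dζ − ∫_{ℝ³} (ε/|ζ|) · w(ζ)/|ζ* − z| dζ ] for |z| < ε, and h_ε(z) = 0 for |z| ≥ ε. Then h_ε is continuously differentiable on the open ball {z : |z| < ε}, and there is a constant K depending only on β, c, C such that ∫_{|z|<ε} |∇h_ε(z)|² dz ≤ K μ^{2−β}; in particular ‖∇h_ε‖_{L²} ≤ K^{1/2} μ^{1−β/2} there. -/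
open MeasureTheory

/-- The auxiliary potential `h_ε` of Definition 5.2, solving `Δh_ε = w` on the ball of
radius `ε` with Dirichlet boundary conditions, extended by `0` outside the ball. -/
noncomputable def heps (ε : ℝ) (w : EuclideanSpace ℝ (Fin 3) → ℝ)
    (z : EuclideanSpace ℝ (Fin 3)) : ℝ :=
  if ‖z‖ < ε then
    (1 / (4 * Real.pi)) *
      ((∫ ζ, w ζ / ‖z - ζ‖) - ∫ ζ, (ε / ‖ζ‖) * (w ζ / ‖(ε ^ 2 / ‖ζ‖ ^ 2) • ζ - z‖))
  else 0

section Kernel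

variable {E : Type*} [NormedAddCommGroup E]

/-- The regularized Newton kernel `(δ + ‖x‖²)^(-1/2)`; at `δ = 0` it is `‖x‖⁻¹`. -/
noncomputable def regKernel (δ : ℝ) (x : E) : ℝ := (√(δ + ‖x‖ ^ 2))⁻¹

lemma regKernel_zero (x : E) : regKernel 0 x = ‖x‖⁻¹ := by
  simp [regKernel]

lemma norm_le_sqrt_add {δ : ℝ} (hδ : 0 ≤ δ) (x : E) : ‖x‖ ≤ √(δ + ‖x‖ ^ 2) :=
  Real.le_sqrt_of_sq_le (by linarith)

lemma regKernel_nonneg (δ : ℝ) (x : E) : 0 ≤ regKernel δ x := by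
  unfold regKernel; positivity

lemma regKernel_le {δ : ℝ} (hδ : 0 ≤ δ) {x : E} (hx : x ≠ 0) : regKernel δ x ≤ ‖x‖⁻¹ :=
  inv_anti₀ (norm_pos_iff.2 hx) (norm_le_sqrt_add hδ x)

lemma regKernel_le_of_pos {δ : ℝ} (hδ : 0 < δ) (x : E) : regKernel δ x ≤ (√δ)⁻¹ :=
  inv_anti₀ (Real.sqrt_pos.2 hδ) (Real.sqrt_le_sqrt (by nlinarith [sq_nonneg ‖x‖]))

lemma measurable_regKernel [MeasurableSpace E] [BorelSpace E] (δ : ℝ) :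
    Measurable (regKernel (E := E) δ) := by
  unfold regKernel; fun_prop

lemma tendsto_regKernel {x : E} (hx : x ≠ 0) {u : ℕ → ℝ}
    (hu : Filter.Tendsto u Filter.atTop (nhds 0)) :
    Filter.Tendsto (fun n => regKernel (u n) x) Filter.atTop (nhds (regKernel 0 x)) := by
  have hs : √(0 + ‖x‖ ^ 2) ≠ 0 := by simpa using hx
  exact ((hu.add_const _).sqrt).inv₀ hs

variable [InnerProductSpace ℝ E]

/-- The derivative of `regKernel δ`. -/
noncomputable def regKernelDeriv (δ : ℝ) (x : E) : E →L[ℝ] ℝ :=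
  (-(√(δ + ‖x‖ ^ 2))⁻¹ ^ 3) • innerSL ℝ x

lemma hasFDerivAt_regKernel {δ : ℝ} {x : E} (h : 0 < δ + ‖x‖ ^ 2) :
    HasFDerivAt (regKernel δ) (regKernelDeriv δ x) x := by
  have h1 : HasFDerivAt (fun y : E => δ + ‖y‖ ^ 2) (2 • innerSL ℝ x) x :=
    ((hasStrictFDerivAt_norm_sq x).hasFDerivAt).const_add δ
  have hs : √(δ + ‖x‖ ^ 2) ≠ 0 := (Real.sqrt_pos.2 h).ne'
  have h2 := (hasDerivAt_inv hs).comp_hasFDerivAt x (h1.sqrt h.ne')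
  refine h2.congr_fderiv ?_
  ext y
  simp [regKernelDeriv]
  field_simp

lemma continuousAt_regKernelDeriv {δ : ℝ} {x : E} (h : 0 < δ + ‖x‖ ^ 2) :
    ContinuousAt (regKernelDeriv (E := E) δ) x := by
  have hs : √(δ + ‖x‖ ^ 2) ≠ 0 := (Real.sqrt_pos.2 h).ne'
  unfold regKernelDeriv
  have : ContinuousAt (fun x : E => √(δ + ‖x‖ ^ 2)) x := by fun_prop
  have h3 := ((this.inv₀ hs).pow 3).neg
  exact h3.smul (innerSL ℝ (E := E)).continuous.continuousAt

lemma norm_regKernelDeriv (δ : ℝ) (x : E) :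
    ‖regKernelDeriv δ x‖ = (√(δ + ‖x‖ ^ 2))⁻¹ ^ 3 * ‖x‖ := by
  rw [regKernelDeriv, norm_smul, innerSL_apply_norm, norm_neg, Real.norm_of_nonneg (by positivity)]

lemma norm_regKernelDeriv_le {δ : ℝ} (hδ : 0 ≤ δ) (x : E) :
    ‖regKernelDeriv δ x‖ ≤ (‖x‖ ^ 2)⁻¹ := by
  rw [norm_regKernelDeriv]
  rcases eq_or_ne x 0 with rfl | hx
  · simp
  · have hx' := norm_pos_iff.2 hx
    calc (√(δ + ‖x‖ ^ 2))⁻¹ ^ 3 * ‖x‖ ≤ ‖x‖⁻¹ ^ 3 * ‖x‖ := by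
          gcongr; exact norm_le_sqrt_add hδ x
      _ = (‖x‖ ^ 2)⁻¹ := by field_simp

lemma norm_regKernelDeriv_le_of_pos {δ : ℝ} (hδ : 0 < δ) (x : E) :
    ‖regKernelDeriv δ x‖ ≤ (√δ)⁻¹ ^ 2 := by
  rw [norm_regKernelDeriv]
  have hs : 0 < √(δ + ‖x‖ ^ 2) := Real.sqrt_pos.2 (by positivity)
  have h1 : (√(δ + ‖x‖ ^ 2))⁻¹ * ‖x‖ ≤ 1 := by
    rw [inv_mul_le_one₀ hs]; exact norm_le_sqrt_add hδ.le x
  have h2 : (√(δ + ‖x‖ ^ 2))⁻¹ ≤ (√δ)⁻¹ := regKernel_le_of_pos hδ x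
  calc (√(δ + ‖x‖ ^ 2))⁻¹ ^ 3 * ‖x‖
      = (√(δ + ‖x‖ ^ 2))⁻¹ ^ 2 * ((√(δ + ‖x‖ ^ 2))⁻¹ * ‖x‖) := by ring
    _ ≤ (√(δ + ‖x‖ ^ 2))⁻¹ ^ 2 * 1 := by gcongr
    _ ≤ (√δ)⁻¹ ^ 2 := by rw [mul_one]; gcongr

lemma stronglyMeasurable_regKernelDeriv [MeasurableSpace E] [BorelSpace E]
    [SecondCountableTopology E] (δ : ℝ) :
    StronglyMeasurable (regKernelDeriv (E := E) δ) := by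
  unfold regKernelDeriv
  have h : Measurable fun x : E => -(√(δ + ‖x‖ ^ 2))⁻¹ ^ 3 := by fun_prop
  exact h.stronglyMeasurable.smul (innerSL ℝ (E := E)).continuous.stronglyMeasurable

lemma tendsto_regKernelDeriv (x : E) {u : ℕ → ℝ}
    (hu : Filter.Tendsto u Filter.atTop (nhds 0)) :
    Filter.Tendsto (fun n => regKernelDeriv (u n) x) Filter.atTop
      (nhds (regKernelDeriv 0 x)) := by
  rcases eq_or_ne x 0 with rfl | hx
  · simp [regKernelDeriv]
  have hs : √(0 + ‖x‖ ^ 2) ≠ 0 := by simpa using hx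
  exact ((((hu.add_const _).sqrt).inv₀ hs).pow 3).neg.smul_const _

end Kernel

section Radial

lemma integrableOn_inv_norm_ball (R : ℝ) :
    IntegrableOn (fun x : EuclideanSpace ℝ (Fin 3) => ‖x‖⁻¹) (Metric.ball 0 R) := by
  rw [integrableOn_fun_norm_addHaar volume (f := fun y => y⁻¹)]
  have : IntegrableOn (fun y : ℝ => y) (Set.Ioo 0 R) :=
    (continuous_id.integrableOn_Icc (a := 0) (b := R)).mono_set Set.Ioo_subset_Icc_self
  refine this.congr_fun (fun y hy => ?_) measurableSet_Ioo
  have := hy.1.ne'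
  simp
  field_simp

lemma integrableOn_inv_norm_sq_ball (R : ℝ) :
    IntegrableOn (fun x : EuclideanSpace ℝ (Fin 3) => (‖x‖ ^ 2)⁻¹) (Metric.ball 0 R) := by
  rw [integrableOn_fun_norm_addHaar volume (f := fun y => (y ^ 2)⁻¹)]
  have : IntegrableOn (fun y : ℝ => (1 : ℝ)) (Set.Ioo 0 R) := by simp
  refine this.congr_fun (fun y hy => ?_) measurableSet_Ioo
  have := hy.1.ne'
  simp
  field_simp

lemma setIntegral_inv_norm_sq_ball {R : ℝ} (hR : 0 ≤ R) :
    ∫ x in Metric.ball (0 : EuclideanSpace ℝ (Fin 3)) R, (‖x‖ ^ 2)⁻¹ =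
      3 * volume.real (Metric.ball (0 : EuclideanSpace ℝ (Fin 3)) 1) * R := by
  have h1 : (Metric.ball (0 : EuclideanSpace ℝ (Fin 3)) R).indicator (fun x => (‖x‖ ^ 2)⁻¹) =
      fun x => (Set.Iio R).indicator (fun y : ℝ => (y ^ 2)⁻¹) ‖x‖ := by
    ext x; simp [Set.indicator]
  rw [← integral_indicator measurableSet_ball, h1, integral_fun_norm_addHaar]
  have h2 : ∫ y in Set.Ioi (0 : ℝ), y ^ (Module.finrank ℝ (EuclideanSpace ℝ (Fin 3)) - 1) •
      (Set.Iio R).indicator (fun y : ℝ => (y ^ 2)⁻¹) y = ∫ y in Set.Ioo 0 R, (1 : ℝ) := by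
    rw [← integral_indicator measurableSet_Ioi, ← integral_indicator measurableSet_Ioo]
    congr 1; ext y
    by_cases h0 : 0 < y <;> by_cases hr : y < R <;> simp [Set.indicator, h0, hr]
    field_simp
  rw [h2]
  simp [hR]
  ring

lemma integrable_inv_norm_pow_four_indicator {R : ℝ} (hR : 0 < R) :
    Integrable (fun x : EuclideanSpace ℝ (Fin 3) =>
      (Set.Ioi R).indicator (fun y : ℝ => (y ^ 4)⁻¹) ‖x‖) ∧
    ∫ x : EuclideanSpace ℝ (Fin 3), (Set.Ioi R).indicator (fun y : ℝ => (y ^ 4)⁻¹) ‖x‖ =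
      3 * volume.real (Metric.ball (0 : EuclideanSpace ℝ (Fin 3)) 1) * R⁻¹ := by
  have h1 : (Set.Ioi (0 : ℝ)).indicator (fun y : ℝ =>
        y ^ (Module.finrank ℝ (EuclideanSpace ℝ (Fin 3)) - 1) •
        (Set.Ioi R).indicator (fun y : ℝ => (y ^ 4)⁻¹) y) =
      (Set.Ioi R).indicator (fun y : ℝ => y ^ (-2 : ℝ)) := by
    ext y
    by_cases hr : R < y
    · have h0 : 0 < y := hR.trans hr
      simp [Set.indicator, h0, hr]
      field_simp
    · simp [Set.indicator, hr]
  constructor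
  · rw [integrable_fun_norm_addHaar volume (f := (Set.Ioi R).indicator (fun y : ℝ => (y ^ 4)⁻¹)),
      ← integrable_indicator_iff measurableSet_Ioi, h1, integrable_indicator_iff measurableSet_Ioi]
    exact integrableOn_Ioi_rpow_of_lt (by norm_num) hR
  · rw [integral_fun_norm_addHaar, ← integral_indicator measurableSet_Ioi, h1,
      integral_indicator measurableSet_Ioi, integral_Ioi_rpow_of_lt (by norm_num) hR]
    simp
    norm_num
    rw [Real.rpow_neg_one]
    ring

end Radial

section Potential

/-- Differentiation under the integral for a bounded `C¹` kernel against an integrable density. -/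
lemma hasFDerivAt_integral_mul_of_bounded {α E : Type*} [MeasurableSpace α] {m : Measure α}
    [NormedAddCommGroup E] [NormedSpace ℝ E] {w : α → ℝ} (hw : Integrable w m)
    {U : Set E} (hU : IsOpen U) {k : E → α → ℝ} {k' : E → α → E →L[ℝ] ℝ} {A B : ℝ}
    (hk_meas : ∀ z ∈ U, AEStronglyMeasurable (k z) m)
    (hk'_meas : ∀ z ∈ U, AEStronglyMeasurable (k' z) m)
    (hk_le : ∀ᵐ ζ ∂m, w ζ ≠ 0 → ∀ z ∈ U, ‖k z ζ‖ ≤ A)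
    (hk'_le : ∀ᵐ ζ ∂m, w ζ ≠ 0 → ∀ z ∈ U, ‖k' z ζ‖ ≤ B)
    (hderiv : ∀ᵐ ζ ∂m, w ζ ≠ 0 → ∀ z ∈ U, HasFDerivAt (k · ζ) (k' z ζ) z)
    (hcont : ∀ᵐ ζ ∂m, w ζ ≠ 0 → ∀ z ∈ U, ContinuousAt (k' · ζ) z) :
    (∀ z ∈ U, HasFDerivAt (fun z => ∫ ζ, w ζ * k z ζ ∂m) (∫ ζ, w ζ • k' z ζ ∂m) z) ∧
      ContinuousOn (fun z => ∫ ζ, w ζ • k' z ζ ∂m) U ∧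
      ∀ z ∈ U, ‖∫ ζ, w ζ • k' z ζ ∂m‖ ≤ (∫ ζ, ‖w ζ‖ ∂m) * B := by
  have hbound : ∀ᵐ ζ ∂m, ∀ z ∈ U, ‖w ζ • k' z ζ‖ ≤ ‖w ζ‖ * B := by
    filter_upwards [hk'_le] with ζ h z hz
    rw [norm_smul]
    by_cases h0 : w ζ = 0
    · simp [h0]
    · exact mul_le_mul_of_nonneg_left (h h0 z hz) (norm_nonneg _)
  have hmeas' : ∀ z ∈ U, AEStronglyMeasurable (fun ζ => w ζ • k' z ζ) m := fun z hz =>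
    hw.aestronglyMeasurable.smul (hk'_meas z hz)
  have hmeas : ∀ z ∈ U, AEStronglyMeasurable (fun ζ => w ζ * k z ζ) m := fun z hz =>
    hw.aestronglyMeasurable.mul (hk_meas z hz)
  refine ⟨fun z hz => ?_, ?_, fun z hz => ?_⟩
  · refine hasFDerivAt_integral_of_dominated_of_fderiv_le (s := U) (hU.mem_nhds hz)
      (bound := fun ζ => ‖w ζ‖ * B)
      (by filter_upwards [hU.mem_nhds hz] with y hy using hmeas y hy) ?_ (hmeas' z hz)
      hbound (hw.norm.mul_const B) ?_
    · refine (hw.norm.mul_const A).mono' (hmeas z hz) ?_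
      filter_upwards [hk_le] with ζ h
      rw [norm_mul]
      by_cases h0 : w ζ = 0
      · simp [h0]
      · exact mul_le_mul_of_nonneg_left (h h0 z hz) (norm_nonneg _)
    · filter_upwards [hderiv] with ζ h y hy
      by_cases h0 : w ζ = 0
      · simpa [h0] using hasFDerivAt_const (0 : ℝ) y
      · exact (h h0 y hy).const_mul (w ζ)
  · refine continuousOn_of_dominated hmeas' (bound := fun ζ => ‖w ζ‖ * B)
      (fun z hz => hbound.mono fun ζ h => h z hz) (hw.norm.mul_const B) ?_
    filter_upwards [hcont] with ζ h y hy
    by_cases h0 : w ζ = 0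
    · simpa [h0] using continuousWithinAt_const
    · exact ((h h0 y hy).const_smul (w ζ)).continuousWithinAt
  · rw [← integral_mul_const]
    exact norm_integral_le_of_norm_le (hw.norm.mul_const B) (hbound.mono fun ζ h => h z hz)

variable {E : Type*} [NormedAddCommGroup E] [MeasurableSpace E] [BorelSpace E]
  {m : Measure E} [m.IsAddLeftInvariant] [m.IsNegInvariant]

/-- A bounded density supported in a ball, integrated against a translate of a locally integrable
kernel. -/
lemma integrable_mul_comp_sub_and_integral_le {w φ : E → ℝ} (hw : AEStronglyMeasurable w m)
    (hw0 : ∀ ζ, 0 ≤ w ζ) {M ϱ r : ℝ} (hwM : ∀ᵐ ζ ∂m, w ζ ≤ M)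
    (hsupp : ∀ ζ, w ζ ≠ 0 → ‖ζ‖ ≤ ϱ) (hφ0 : ∀ x, 0 ≤ φ x)
    (hφ : IntegrableOn φ (Metric.ball 0 r) m) {z : E} (hz : ‖z‖ + ϱ < r) :
    Integrable (fun ζ => w ζ * φ (z - ζ)) m ∧
      ∫ ζ, w ζ * φ (z - ζ) ∂m ≤ M * ∫ x in Metric.ball 0 r, φ x ∂m := by
  have hΦ := hφ.integrable_indicator measurableSet_ball
  have hΦz : Integrable (fun ζ => (Metric.ball 0 r).indicator φ (z - ζ)) m := hΦ.comp_sub_left z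
  have heq : (fun ζ => w ζ * φ (z - ζ)) =
      fun ζ => w ζ * (Metric.ball 0 r).indicator φ (z - ζ) := by
    ext ζ
    by_cases h0 : w ζ = 0
    · simp [h0]
    · have : z - ζ ∈ Metric.ball 0 r := by
        rw [mem_ball_zero_iff]
        linarith [norm_sub_le z ζ, hsupp ζ h0]
      rw [Set.indicator_of_mem this]
  have hΦ0 : ∀ x, 0 ≤ (Metric.ball 0 r).indicator φ x :=
    fun x => Set.indicator_nonneg (fun x _ => hφ0 x) x
  have hint : Integrable (fun ζ => w ζ * (Metric.ball 0 r).indicator φ (z - ζ)) m := by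
    refine (hΦz.const_mul M).mono' (hw.mul hΦz.aestronglyMeasurable) ?_
    filter_upwards [hwM] with ζ h
    rw [Real.norm_of_nonneg (mul_nonneg (hw0 ζ) (hΦ0 _))]
    exact mul_le_mul_of_nonneg_right h (hΦ0 _)
  rw [heq]
  refine ⟨hint, ?_⟩
  calc ∫ ζ, w ζ * (Metric.ball 0 r).indicator φ (z - ζ) ∂m
      ≤ ∫ ζ, M * (Metric.ball 0 r).indicator φ (z - ζ) ∂m := by
        refine integral_mono_ae hint (hΦz.const_mul M) ?_
        filter_upwards [hwM] with ζ h using mul_le_mul_of_nonneg_right h (hΦ0 _)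
    _ = M * ∫ x in Metric.ball 0 r, φ x ∂m := by
        rw [integral_const_mul, integral_sub_left_eq_self _ m z,
          integral_indicator measurableSet_ball]

end Potential

section Newton

variable {w : EuclideanSpace ℝ (Fin 3) → ℝ} {M ϱ : ℝ}

lemma tendsto_setIntegral_norm_regKernelDeriv_sub (r : ℝ) {u : ℕ → ℝ} (hu0 : ∀ n, 0 ≤ u n)
    (hu : Filter.Tendsto u Filter.atTop (nhds 0)) :
    Filter.Tendsto (fun n => ∫ x in Metric.ball (0 : EuclideanSpace ℝ (Fin 3)) r,
      ‖regKernelDeriv 0 x - regKernelDeriv (u n) x‖) Filter.atTop (nhds 0) := by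
  have key := tendsto_integral_of_dominated_convergence
    (μ := volume.restrict (Metric.ball (0 : EuclideanSpace ℝ (Fin 3)) r))
    (F := fun n x => ‖regKernelDeriv 0 x - regKernelDeriv (u n) x‖) (f := fun _ => 0)
    (fun x => (‖x‖ ^ 2)⁻¹ + (‖x‖ ^ 2)⁻¹)
    (fun n => ((stronglyMeasurable_regKernelDeriv 0).sub
      (stronglyMeasurable_regKernelDeriv (u n))).norm.aestronglyMeasurable)
    ((integrableOn_inv_norm_sq_ball r).add (integrableOn_inv_norm_sq_ball r))
    (fun n => Filter.Eventually.of_forall fun x => ?_)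
    (Filter.Eventually.of_forall fun x => ?_)
  · simpa using key
  · rw [norm_norm]
    exact (norm_sub_le _ _).trans
      (add_le_add (norm_regKernelDeriv_le le_rfl x) (norm_regKernelDeriv_le (hu0 n) x))
  · simpa using ((tendsto_regKernelDeriv x hu).const_sub (regKernelDeriv 0 x)).norm

lemma integrable_smul_regKernelDeriv (hw : Measurable w) (hw0 : ∀ ζ, 0 ≤ w ζ)
    (hwM : ∀ᵐ ζ, w ζ ≤ M) (hsupp : ∀ ζ, w ζ ≠ 0 → ‖ζ‖ ≤ ϱ) {δ : ℝ} (hδ : 0 ≤ δ)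
    (z : EuclideanSpace ℝ (Fin 3)) :
    Integrable fun ζ => w ζ • regKernelDeriv δ (z - ζ) := by
  refine (integrable_mul_comp_sub_and_integral_le hw.aestronglyMeasurable hw0 hwM hsupp
    (fun x => by positivity) (integrableOn_inv_norm_sq_ball (‖z‖ + ϱ + 1))
    (lt_add_one _)).1.mono' ?_ (Filter.Eventually.of_forall fun ζ => ?_)
  · exact (hw.stronglyMeasurable.smul ((stronglyMeasurable_regKernelDeriv δ).comp_measurable
      (measurable_const.sub measurable_id))).aestronglyMeasurable
  · rw [norm_smul, Real.norm_of_nonneg (hw0 ζ)]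
    exact mul_le_mul_of_nonneg_left (norm_regKernelDeriv_le hδ _) (hw0 ζ)

/-- The Newton potential of a bounded compactly supported density is `C¹`. -/
lemma hasFDerivAt_newton (hw : Measurable w) (hwi : Integrable w) (hw0 : ∀ ζ, 0 ≤ w ζ)
    (hwM : ∀ᵐ ζ, w ζ ≤ M) (hsupp : ∀ ζ, w ζ ≠ 0 → ‖ζ‖ ≤ ϱ) (r : ℝ) :
    (∀ z ∈ Metric.ball (0 : EuclideanSpace ℝ (Fin 3)) r,
      HasFDerivAt (fun z => ∫ ζ, w ζ / ‖z - ζ‖) (∫ ζ, w ζ • regKernelDeriv 0 (z - ζ)) z) ∧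
    ContinuousOn (fun z => ∫ ζ, w ζ • regKernelDeriv 0 (z - ζ))
      (Metric.ball (0 : EuclideanSpace ℝ (Fin 3)) r) := by
  set u : ℕ → ℝ := fun n => 1 / ((n : ℝ) + 1)
  have hupos : ∀ n, 0 < u n := fun n => Nat.one_div_pos_of_nat
  have hu : Filter.Tendsto u Filter.atTop (nhds 0) := tendsto_one_div_add_atTop_nhds_zero_nat
  have hreg : ∀ n,
      (∀ z ∈ Metric.ball (0 : EuclideanSpace ℝ (Fin 3)) r,
        HasFDerivAt (fun z => ∫ ζ, w ζ * regKernel (u n) (z - ζ))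
          (∫ ζ, w ζ • regKernelDeriv (u n) (z - ζ)) z) ∧
      ContinuousOn (fun z => ∫ ζ, w ζ • regKernelDeriv (u n) (z - ζ))
        (Metric.ball (0 : EuclideanSpace ℝ (Fin 3)) r) := by
    intro n
    have hpos : ∀ x : EuclideanSpace ℝ (Fin 3), 0 < u n + ‖x‖ ^ 2 := fun x =>
      add_pos_of_pos_of_nonneg (hupos n) (by positivity)
    have h := hasFDerivAt_integral_mul_of_bounded hwi
      (Metric.isOpen_ball (x := (0 : EuclideanSpace ℝ (Fin 3))) (ε := r))
      (k := fun z ζ => regKernel (u n) (z - ζ)) (k' := fun z ζ => regKernelDeriv (u n) (z - ζ))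
      (A := (√(u n))⁻¹) (B := (√(u n))⁻¹ ^ 2)
      (fun z _ => ((measurable_regKernel (u n)).comp
        (measurable_const.sub measurable_id)).aestronglyMeasurable)
      (fun z _ => ((stronglyMeasurable_regKernelDeriv (u n)).comp_measurable
        (measurable_const.sub measurable_id)).aestronglyMeasurable)
      (.of_forall fun ζ _ z _ => by
        rw [Real.norm_of_nonneg (regKernel_nonneg _ _)]
        exact regKernel_le_of_pos (hupos n) _)
      (.of_forall fun ζ _ z _ => norm_regKernelDeriv_le_of_pos (hupos n) _)
      (.of_forall fun ζ _ z _ => by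
        simpa [Function.comp_def] using
          (hasFDerivAt_regKernel (hpos (z - ζ))).comp z ((hasFDerivAt_id z).sub_const ζ))
      (.of_forall fun ζ _ z _ =>
        ContinuousAt.comp (f := fun z => z - ζ) (continuousAt_regKernelDeriv (hpos (z - ζ)))
          (by fun_prop))
    exact ⟨h.1, h.2.1⟩
  have hunif : TendstoUniformlyOn (fun n z => ∫ ζ, w ζ • regKernelDeriv (u n) (z - ζ))
      (fun z => ∫ ζ, w ζ • regKernelDeriv 0 (z - ζ)) Filter.atTop
      (Metric.ball (0 : EuclideanSpace ℝ (Fin 3)) r) := by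
    rw [Metric.tendstoUniformlyOn_iff]
    intro η hη
    have hlim := (tendsto_setIntegral_norm_regKernelDeriv_sub (r + ϱ)
      (fun n => (hupos n).le) hu).const_mul M
    rw [mul_zero] at hlim
    filter_upwards [hlim.eventually_lt_const hη] with n hn z hz
    rw [dist_eq_norm, ← integral_sub
      (integrable_smul_regKernelDeriv hw hw0 hwM hsupp le_rfl z)
      (integrable_smul_regKernelDeriv hw hw0 hwM hsupp (hupos n).le z)]
    have hφ : IntegrableOn (fun x : EuclideanSpace ℝ (Fin 3) =>
        ‖regKernelDeriv 0 x - regKernelDeriv (u n) x‖) (Metric.ball 0 (r + ϱ)) := by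
      refine ((integrableOn_inv_norm_sq_ball _).add (integrableOn_inv_norm_sq_ball _)).mono'
        ((stronglyMeasurable_regKernelDeriv 0).sub
          (stronglyMeasurable_regKernelDeriv (u n))).norm.aestronglyMeasurable
        (.of_forall fun x => ?_)
      rw [norm_norm]
      exact (norm_sub_le _ _).trans (add_le_add (norm_regKernelDeriv_le le_rfl x)
        (norm_regKernelDeriv_le (hupos n).le x))
    have h := integrable_mul_comp_sub_and_integral_le hw.aestronglyMeasurable hw0 hwM hsupp
      (fun x => norm_nonneg _) hφ (z := z) (by rw [mem_ball_zero_iff] at hz; linarith)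
    refine (norm_integral_le_of_norm_le h.1 (.of_forall fun ζ => ?_)).trans_lt (h.2.trans_lt hn)
    rw [(smul_sub (w ζ) (regKernelDeriv 0 (z - ζ)) (regKernelDeriv (u n) (z - ζ))).symm,
      norm_smul, Real.norm_of_nonneg (hw0 ζ)]
  refine ⟨fun z hz => hasFDerivAt_of_tendstoUniformlyOn Metric.isOpen_ball hunif
    (fun n => (hreg n).1) (fun y hy => ?_) hz,
    hunif.continuousOn (.of_forall fun n => (hreg n).2)⟩
  have hne : ∀ᵐ ζ : EuclideanSpace ℝ (Fin 3), ζ ≠ y := by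
    simp [ae_iff]
  refine tendsto_integral_of_dominated_convergence (fun ζ => w ζ * ‖y - ζ‖⁻¹)
    (fun n => (hw.mul ((measurable_regKernel (u n)).comp
        (measurable_const.sub measurable_id))).aestronglyMeasurable)
    (integrable_mul_comp_sub_and_integral_le hw.aestronglyMeasurable hw0 hwM hsupp
      (fun x => by positivity) (integrableOn_inv_norm_ball (‖y‖ + ϱ + 1)) (lt_add_one _)).1
    (fun n => ?_) ?_
  · filter_upwards [hne] with ζ h
    rw [norm_mul, Real.norm_of_nonneg (hw0 ζ), Real.norm_of_nonneg (regKernel_nonneg _ _)]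
    exact mul_le_mul_of_nonneg_left (regKernel_le (hupos n).le (sub_ne_zero.2 h.symm)) (hw0 ζ)
  · filter_upwards [hne] with ζ h
    rw [div_eq_mul_inv, ← regKernel_zero]
    exact (tendsto_regKernel (sub_ne_zero.2 h.symm) hu).const_mul _

lemma norm_newton_deriv_le (hw : Measurable w) (hw0 : ∀ ζ, 0 ≤ w ζ)
    (hwM : ∀ᵐ ζ, w ζ ≤ M) (hsupp : ∀ ζ, w ζ ≠ 0 → ‖ζ‖ ≤ ϱ) (hϱ : 0 < ϱ)
    {z : EuclideanSpace ℝ (Fin 3)} (hz : ‖z‖ ≤ 2 * ϱ) :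
    ‖∫ ζ, w ζ • regKernelDeriv 0 (z - ζ)‖ ≤
      M * (3 * volume.real (Metric.ball (0 : EuclideanSpace ℝ (Fin 3)) 1) * (4 * ϱ)) := by
  have h := integrable_mul_comp_sub_and_integral_le hw.aestronglyMeasurable hw0 hwM hsupp
    (fun x => by positivity) (integrableOn_inv_norm_sq_ball (4 * ϱ)) (z := z) (by linarith)
  rw [setIntegral_inv_norm_sq_ball (by positivity)] at h
  refine (norm_integral_le_of_norm_le h.1 (.of_forall fun ζ => ?_)).trans h.2
  rw [norm_smul, Real.norm_of_nonneg (hw0 ζ)]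
  exact mul_le_mul_of_nonneg_left (norm_regKernelDeriv_le le_rfl _) (hw0 ζ)

lemma norm_newton_deriv_le_of_far (hwi : Integrable w) (hw0 : ∀ ζ, 0 ≤ w ζ)
    (hsupp : ∀ ζ, w ζ ≠ 0 → ‖ζ‖ ≤ ϱ) (hϱ : 0 < ϱ)
    {z : EuclideanSpace ℝ (Fin 3)} (hz : 2 * ϱ < ‖z‖) :
    ‖∫ ζ, w ζ • regKernelDeriv 0 (z - ζ)‖ ≤ (∫ ζ, w ζ) * (4 * (‖z‖ ^ 2)⁻¹) := by
  rw [← integral_mul_const]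
  refine norm_integral_le_of_norm_le (hwi.mul_const _) (.of_forall fun ζ => ?_)
  rw [norm_smul, Real.norm_of_nonneg (hw0 ζ)]
  by_cases h0 : w ζ = 0
  · simp [h0]
  refine mul_le_mul_of_nonneg_left ((norm_regKernelDeriv_le le_rfl _).trans ?_) (hw0 ζ)
  have hz0 : 0 < ‖z‖ := by linarith
  have h1 : ‖z‖ / 2 ≤ ‖z - ζ‖ := by linarith [norm_sub_norm_le z ζ, hsupp ζ h0]
  calc (‖z - ζ‖ ^ 2)⁻¹ ≤ ((‖z‖ / 2) ^ 2)⁻¹ := by gcongr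
    _ = 4 * (‖z‖ ^ 2)⁻¹ := by field_simp; norm_num

end Newton

section Image

variable {E : Type*} [NormedAddCommGroup E] [InnerProductSpace ℝ E]

lemma le_norm_inversion_sub {ε ϱ : ℝ} (hϱε : 2 * ϱ < ε) {ζ z : E} (hζ0 : ζ ≠ 0) (hζ : ‖ζ‖ ≤ ϱ)
    (hz : ‖z‖ < ε) : ε ^ 2 / (2 * ‖ζ‖) ≤ ‖(ε ^ 2 / ‖ζ‖ ^ 2) • ζ - z‖ := by
  have h0 : 0 < ‖ζ‖ := norm_pos_iff.2 hζ0
  have hε : 0 < ε := by linarith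
  have h1 : ‖(ε ^ 2 / ‖ζ‖ ^ 2) • ζ‖ = 2 * (ε ^ 2 / (2 * ‖ζ‖)) := by
    rw [norm_smul, Real.norm_of_nonneg (by positivity)]; field_simp
  have h2 : ε ≤ ε ^ 2 / (2 * ‖ζ‖) := by
    rw [le_div_iff₀ (by positivity)]; nlinarith
  linarith [norm_sub_norm_le ((ε ^ 2 / ‖ζ‖ ^ 2) • ζ) z]

/-- The potential of the image charges is `C¹` in the ball, with an explicit gradient bound. -/
lemma exists_hasFDerivAt_image_potential [MeasurableSpace E] [BorelSpace E]
    [SecondCountableTopology E] {m : Measure E} [NullSingletonClass m] {w : E → ℝ}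
    (hwi : Integrable w m) {ε ϱ : ℝ} (hε : 0 < ε) (hϱε : 2 * ϱ < ε) (hsupp : ∀ ζ, w ζ ≠ 0 → ‖ζ‖ ≤ ϱ) :
    ∃ R' : E → E →L[ℝ] ℝ,
      (∀ z ∈ Metric.ball (0 : E) ε, HasFDerivAt
        (fun z => ∫ ζ, (ε / ‖ζ‖) * (w ζ / ‖(ε ^ 2 / ‖ζ‖ ^ 2) • ζ - z‖) ∂m) (R' z) z) ∧
      ContinuousOn R' (Metric.ball 0 ε) ∧
      ∀ z ∈ Metric.ball (0 : E) ε, ‖R' z‖ ≤ (∫ ζ, ‖w ζ‖ ∂m) * (2 / ε ^ 2) := by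
  have hp : Measurable fun ζ : E => (ε ^ 2 / ‖ζ‖ ^ 2) • ζ := by fun_prop
  have hc : Measurable fun ζ : E => ε / ‖ζ‖ := by fun_prop
  have hne : ∀ᵐ ζ ∂m, ζ ≠ 0 := by simp [ae_iff]
  have hx : ∀ ζ : E, ζ ≠ 0 → w ζ ≠ 0 → ∀ z ∈ Metric.ball (0 : E) ε,
      0 < ‖ζ‖ ∧ 0 < ‖(ε ^ 2 / ‖ζ‖ ^ 2) • ζ - z‖ ∧
        ‖(ε ^ 2 / ‖ζ‖ ^ 2) • ζ - z‖⁻¹ ≤ 2 * ‖ζ‖ / ε ^ 2 := by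
    intro ζ h0 hwζ z hz
    have h := le_norm_inversion_sub hϱε h0 (hsupp ζ hwζ) (mem_ball_zero_iff.1 hz)
    have h0' := norm_pos_iff.2 h0
    have hpos : 0 < ε ^ 2 / (2 * ‖ζ‖) := by positivity
    refine ⟨h0', hpos.trans_le h, ?_⟩
    rw [← inv_div (ε ^ 2) (2 * ‖ζ‖)]
    exact inv_anti₀ hpos h
  have h := hasFDerivAt_integral_mul_of_bounded hwi
    (Metric.isOpen_ball (x := (0 : E)) (ε := ε))
    (k := fun z ζ => (ε / ‖ζ‖) * regKernel 0 ((ε ^ 2 / ‖ζ‖ ^ 2) • ζ - z))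
    (k' := fun z ζ => (ε / ‖ζ‖) • -regKernelDeriv 0 ((ε ^ 2 / ‖ζ‖ ^ 2) • ζ - z))
    (A := 2 / ε) (B := 2 / ε ^ 2)
    (fun z _ => (hc.mul ((measurable_regKernel 0).comp (hp.sub_const z))).aestronglyMeasurable)
    (fun z _ => (hc.stronglyMeasurable.smul ((stronglyMeasurable_regKernelDeriv 0).comp_measurable
      (hp.sub_const z)).neg).aestronglyMeasurable)
    (by
      filter_upwards [hne] with ζ h0 hwζ z hz
      obtain ⟨h1, h2, h3⟩ := hx ζ h0 hwζ z hz
      rw [regKernel_zero, Real.norm_of_nonneg (by positivity)]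
      calc ε / ‖ζ‖ * ‖(ε ^ 2 / ‖ζ‖ ^ 2) • ζ - z‖⁻¹ ≤ ε / ‖ζ‖ * (2 * ‖ζ‖ / ε ^ 2) := by gcongr
        _ = 2 / ε := by field_simp)
    (by
      filter_upwards [hne] with ζ h0 hwζ z hz
      obtain ⟨h1, h2, h3⟩ := hx ζ h0 hwζ z hz
      have h4 : 2 * ‖ζ‖ ≤ ε := by linarith [hsupp ζ hwζ]
      rw [norm_smul, norm_neg, Real.norm_of_nonneg (by positivity)]
      calc ε / ‖ζ‖ * ‖regKernelDeriv 0 ((ε ^ 2 / ‖ζ‖ ^ 2) • ζ - z)‖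
          ≤ ε / ‖ζ‖ * (‖(ε ^ 2 / ‖ζ‖ ^ 2) • ζ - z‖⁻¹ ^ 2) := by
            rw [inv_pow]; gcongr; exact norm_regKernelDeriv_le le_rfl _
        _ ≤ ε / ‖ζ‖ * (2 * ‖ζ‖ / ε ^ 2) ^ 2 := by gcongr
        _ = 2 * (2 * ‖ζ‖) / ε ^ 3 := by field_simp
        _ ≤ 2 * ε / ε ^ 3 := by gcongr
        _ = 2 / ε ^ 2 := by field_simp)
    (by
      filter_upwards [hne] with ζ h0 hwζ z hz
      have h2 := (hx ζ h0 hwζ z hz).2.1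
      have h3 := (hasFDerivAt_regKernel (δ := 0) (by positivity)).comp z
        ((hasFDerivAt_id z).const_sub ((ε ^ 2 / ‖ζ‖ ^ 2) • ζ))
      refine (h3.const_mul (ε / ‖ζ‖)).congr_fderiv ?_
      ext y; simp)
    (by
      filter_upwards [hne] with ζ h0 hwζ z hz
      have h2 := (hx ζ h0 hwζ z hz).2.1
      have h3 : ContinuousAt (fun z => regKernelDeriv 0 ((ε ^ 2 / ‖ζ‖ ^ 2) • ζ - z)) z :=
        ContinuousAt.comp (f := fun z => (ε ^ 2 / ‖ζ‖ ^ 2) • ζ - z)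
          (continuousAt_regKernelDeriv (δ := 0) (by positivity)) (by fun_prop)
      exact h3.neg.const_smul (ε / ‖ζ‖))
  have heq : (fun z => ∫ ζ, (ε / ‖ζ‖) * (w ζ / ‖(ε ^ 2 / ‖ζ‖ ^ 2) • ζ - z‖) ∂m) =
      fun z => ∫ ζ, w ζ * ((ε / ‖ζ‖) * regKernel 0 ((ε ^ 2 / ‖ζ‖ ^ 2) • ζ - z)) ∂m := by
    ext z
    refine integral_congr_ae (.of_forall fun ζ => ?_)
    simp only [regKernel_zero]
    ring
  rw [heq]
  exact ⟨_, h⟩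

end Image

lemma gradient_energy_le {N R A B : ℝ} (hN : 0 ≤ N) (hR : 0 ≤ R) (hA : N ^ 2 ≤ A) (hB : R ≤ B) :
    (1 / (4 * Real.pi) * (N + R)) ^ 2 ≤ 2 * A + 2 * B ^ 2 := by
  have hπ : 1 / (4 * Real.pi) ≤ 1 := by
    rw [div_le_one (by positivity)]; linarith [Real.pi_gt_three]
  calc (1 / (4 * Real.pi) * (N + R)) ^ 2 ≤ (1 * (N + R)) ^ 2 := by gcongr
    _ ≤ 2 * N ^ 2 + 2 * R ^ 2 := by nlinarith [sq_nonneg (N - R)]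
    _ ≤ 2 * A + 2 * B ^ 2 := by gcongr

lemma energy_bound_le {c C V μ t ϱ ε : ℝ} (hc : 0 < c) (hC : 0 < C) (hV : 0 ≤ V) (hμ : 0 < μ)
    (ht : 0 < t) (h1 : c * t ≤ ϱ) (h2 : ϱ ≤ C * t) (h3 : 2 * ϱ < ε) :
    (2 * ϱ) ^ 3 * V * (2 * (C * (μ / t ^ 3) * (3 * V * (4 * ϱ))) ^ 2) +
        2 * (4 * (C * μ)) ^ 2 * (3 * V * (2 * ϱ)⁻¹) + ε ^ 3 * V * (2 * (C * μ * (2 / ε ^ 2)) ^ 2) ≤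
      (2304 * V ^ 3 * C ^ 7 + 52 * C ^ 2 * V / c + 1) * (μ ^ 2 / t) := by
  have hϱ : 0 < ϱ := (mul_pos hc ht).trans_le h1
  have hε : 0 < ε := by linarith
  have hinv : ϱ⁻¹ ≤ (c * t)⁻¹ := inv_anti₀ (by positivity) h1
  have hinv' : ε⁻¹ ≤ (2 * (c * t))⁻¹ := inv_anti₀ (by positivity) (by linarith)
  have e1 : (2 * ϱ) ^ 3 * V * (2 * (C * (μ / t ^ 3) * (3 * V * (4 * ϱ))) ^ 2) ≤
      2304 * V ^ 3 * C ^ 7 * (μ ^ 2 / t) := by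
    calc _ = 2304 * V ^ 3 * C ^ 2 * (μ ^ 2 / t ^ 6) * ϱ ^ 5 := by field_simp; ring
      _ ≤ 2304 * V ^ 3 * C ^ 2 * (μ ^ 2 / t ^ 6) * (C * t) ^ 5 := by gcongr
      _ = _ := by field_simp
  have e2 : 2 * (4 * (C * μ)) ^ 2 * (3 * V * (2 * ϱ)⁻¹) ≤ 48 * C ^ 2 * V / c * (μ ^ 2 / t) := by
    calc _ = 48 * C ^ 2 * V * μ ^ 2 * ϱ⁻¹ := by field_simp; ring
      _ ≤ 48 * C ^ 2 * V * μ ^ 2 * (c * t)⁻¹ := by gcongr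
      _ = _ := by field_simp
  have e3 : ε ^ 3 * V * (2 * (C * μ * (2 / ε ^ 2)) ^ 2) ≤ 4 * C ^ 2 * V / c * (μ ^ 2 / t) := by
    calc _ = 8 * C ^ 2 * V * μ ^ 2 * ε⁻¹ := by field_simp; ring
      _ ≤ 8 * C ^ 2 * V * μ ^ 2 * (2 * (c * t))⁻¹ := by gcongr
      _ = _ := by field_simp; ring
  have e4 : 0 ≤ μ ^ 2 / t := by positivity
  calc _ ≤ _ := add_le_add (add_le_add e1 e2) e3
    _ ≤ _ := by rw [← sub_nonneg]; ring_nf; ring_nf at e4; exact e4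

theorem stmt13 (β c C : ℝ) (hβ : β ∈ Set.Ioo (0 : ℝ) 1) (hc : 0 < c) (hC : 0 < C) :
    ∃ K > (0 : ℝ), ∀ μ ε : ℝ, μ ∈ Set.Ioo (0 : ℝ) 1 → ε ∈ Set.Ioo (0 : ℝ) 1 →
      ∀ (w : EuclideanSpace ℝ (Fin 3) → ℝ) (ϱ : ℝ),
        Measurable w → (∀ ζ, 0 ≤ w ζ) →
        eLpNorm w ⊤ (volume : Measure (EuclideanSpace ℝ (Fin 3))) ≤
          ENNReal.ofReal (C * μ ^ (1 - 3 * β)) →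
        (∫ ζ, w ζ) ≤ C * μ →
        (∀ ζ, w ζ ≠ 0 → ‖ζ‖ ≤ ϱ) →
        c * μ ^ β ≤ ϱ → ϱ ≤ C * μ ^ β → 2 * ϱ < ε →
        ContDiffOn ℝ 1 (heps ε w) (Metric.ball 0 ε) ∧
          (∫ z in Metric.ball (0 : EuclideanSpace ℝ (Fin 3)) ε,
              ‖gradient (heps ε w) z‖ ^ 2) ≤ K * μ ^ (2 - β) ∧
          Real.sqrt (∫ z in Metric.ball (0 : EuclideanSpace ℝ (Fin 3)) ε,
              ‖gradient (heps ε w) z‖ ^ 2) ≤ Real.sqrt K * μ ^ (1 - β / 2) := by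
  set V := volume.real (Metric.ball (0 : EuclideanSpace ℝ (Fin 3)) 1) with hVdef
  have hV : 0 ≤ V := measureReal_nonneg
  refine ⟨2304 * V ^ 3 * C ^ 7 + 52 * C ^ 2 * V / c + 1, by positivity, ?_⟩
  intro μ ε hμ hε w ϱ hw hw0 hwtop hwint hsupp hϱ1 hϱ2 hϱε
  have hμ0 : 0 < μ := hμ.1
  set t := μ ^ β
  have ht0 : 0 < t := Real.rpow_pos_of_pos hμ0 _
  have hϱ : 0 < ϱ := (mul_pos hc ht0).trans_le hϱ1
  have hM : μ ^ (1 - 3 * β) = μ / t ^ 3 := by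
    rw [Real.rpow_sub hμ0, Real.rpow_one, mul_comm, Real.rpow_mul hμ0.le]
    norm_cast
  have hμβ : μ ^ (2 - β) = μ ^ 2 / t := by
    rw [Real.rpow_sub hμ0]; norm_cast
  rw [hM] at hwtop
  set M := C * (μ / t ^ 3)
  have hM0 : 0 ≤ M := by positivity
  have hwM : ∀ᵐ ζ, w ζ ≤ M := by
    rw [eLpNorm_exponent_top] at hwtop
    filter_upwards [ae_le_eLpNormEssSup (f := w)
      (μ := (volume : Measure (EuclideanSpace ℝ (Fin 3))))] with ζ h
    have := h.trans hwtop
    rwa [Real.enorm_of_nonneg (hw0 ζ), ENNReal.ofReal_le_ofReal_iff hM0] at this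
  have hwi : Integrable w := by
    have h : Integrable ((Metric.closedBall (0 : EuclideanSpace ℝ (Fin 3)) ϱ).indicator
        fun _ => M) :=
      (integrableOn_const (hs := measure_closedBall_lt_top.ne)).integrable_indicator
        measurableSet_closedBall
    refine h.mono' hw.aestronglyMeasurable ?_
    filter_upwards [hwM] with ζ hζ
    rw [Real.norm_of_nonneg (hw0 ζ)]
    by_cases h0 : w ζ = 0
    · rw [h0]; exact Set.indicator_nonneg (fun _ _ => hM0) _
    · rwa [Set.indicator_of_mem (mem_closedBall_zero_iff.2 (hsupp ζ h0))]
  obtain ⟨hN, hNc⟩ := hasFDerivAt_newton hw hwi hw0 hwM hsupp ε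
  obtain ⟨R', hR, hRc, hRle⟩ := exists_hasFDerivAt_image_potential hwi hε.1 hϱε hsupp
  set N' : EuclideanSpace ℝ (Fin 3) → EuclideanSpace ℝ (Fin 3) →L[ℝ] ℝ :=
    fun z => ∫ ζ, w ζ • regKernelDeriv 0 (z - ζ)
  have hD : ∀ z ∈ Metric.ball (0 : EuclideanSpace ℝ (Fin 3)) ε,
      HasFDerivAt (heps ε w) ((1 / (4 * Real.pi)) • (N' z - R' z)) z := by
    intro z hz
    refine (((hN z hz).sub (hR z hz)).const_mul (1 / (4 * Real.pi))).congr_of_eventuallyEq ?_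
    filter_upwards [Metric.isOpen_ball.mem_nhds hz] with y hy
    rw [heps, if_pos (mem_ball_zero_iff.1 hy)]
    rfl
  have hC1 : ContDiffOn ℝ 1 (heps ε w) (Metric.ball 0 ε) := by
    rw [← zero_add (1 : WithTop ℕ∞), contDiffOn_succ_iff_fderiv_of_isOpen Metric.isOpen_ball]
    refine ⟨fun z hz => (hD z hz).differentiableAt.differentiableWithinAt, by simp, ?_⟩
    rw [contDiffOn_zero]
    exact ((hNc.sub hRc).const_smul (1 / (4 * Real.pi))).congr fun z hz => (hD z hz).fderiv
  have hgrad : ∀ z ∈ Metric.ball (0 : EuclideanSpace ℝ (Fin 3)) ε,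
      ‖gradient (heps ε w) z‖ ≤ 1 / (4 * Real.pi) * (‖N' z‖ + ‖R' z‖) := by
    intro z hz
    rw [gradient, LinearIsometryEquiv.norm_map, (hD z hz).fderiv, norm_smul,
      Real.norm_of_nonneg (by positivity)]
    gcongr
    exact norm_sub_le _ _
  have hw1 : ∫ ζ, ‖w ζ‖ = ∫ ζ, w ζ :=
    integral_congr_ae (.of_forall fun ζ => Real.norm_of_nonneg (hw0 ζ))
  have hbR : ∀ z ∈ Metric.ball (0 : EuclideanSpace ℝ (Fin 3)) ε,
      ‖R' z‖ ≤ C * μ * (2 / ε ^ 2) := fun z hz =>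
    (hRle z hz).trans (by rw [hw1]; gcongr)
  obtain ⟨hI4, hI4v⟩ := integrable_inv_norm_pow_four_indicator (R := 2 * ϱ) (by positivity)
  set a := M * (3 * V * (4 * ϱ))
  set B := C * μ * (2 / ε ^ 2)
  set P : EuclideanSpace ℝ (Fin 3) → ℝ :=
    (Metric.closedBall 0 (2 * ϱ)).indicator fun _ => 2 * a ^ 2 with hP
  set Q : EuclideanSpace ℝ (Fin 3) → ℝ := fun z => 2 * (4 * (C * μ)) ^ 2 *
    (Set.Ioi (2 * ϱ)).indicator (fun y : ℝ => (y ^ 4)⁻¹) ‖z‖ with hQ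
  set S : EuclideanSpace ℝ (Fin 3) → ℝ :=
    (Metric.closedBall 0 ε).indicator fun _ => 2 * B ^ 2 with hS
  have hPi : Integrable P := (integrableOn_const
    (hs := measure_closedBall_lt_top.ne)).integrable_indicator measurableSet_closedBall
  have hSi : Integrable S := (integrableOn_const
    (hs := measure_closedBall_lt_top.ne)).integrable_indicator measurableSet_closedBall
  have hQi : Integrable Q := hI4.const_mul _
  have hP0 : ∀ z, 0 ≤ P z := fun z => Set.indicator_nonneg (fun _ _ => by positivity) z
  have hS0 : ∀ z, 0 ≤ S z := fun z => Set.indicator_nonneg (fun _ _ => by positivity) z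
  have hQ0 : ∀ z, 0 ≤ Q z := fun z =>
    mul_nonneg (by positivity) (Set.indicator_nonneg (fun y _ => by positivity) _)
  have hpt : ∀ z ∈ Metric.ball (0 : EuclideanSpace ℝ (Fin 3)) ε,
      ‖gradient (heps ε w) z‖ ^ 2 ≤ P z + Q z + S z := by
    intro z hz
    refine (pow_le_pow_left₀ (norm_nonneg _) (hgrad z hz) 2).trans ?_
    rw [show S z = 2 * B ^ 2 from Set.indicator_of_mem (Metric.ball_subset_closedBall hz) _]
    rcases le_or_gt ‖z‖ (2 * ϱ) with hz2 | hz2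
    · have h := norm_newton_deriv_le hw hw0 hwM hsupp hϱ hz2
      have := gradient_energy_le (norm_nonneg (N' z)) (norm_nonneg (R' z))
        (pow_le_pow_left₀ (norm_nonneg _) h 2) (hbR z hz)
      rw [show P z = 2 * a ^ 2 from
        Set.indicator_of_mem (mem_closedBall_zero_iff.2 hz2) _]
      linarith [hQ0 z]
    · have h := norm_newton_deriv_le_of_far hwi hw0 hsupp hϱ hz2
      have h' : ‖N' z‖ ≤ C * μ * (4 * (‖z‖ ^ 2)⁻¹) := h.trans (by gcongr)
      have := gradient_energy_le (norm_nonneg (N' z)) (norm_nonneg (R' z))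
        (pow_le_pow_left₀ (norm_nonneg _) h' 2) (hbR z hz)
      have hQz : Q z = 2 * (C * μ * (4 * (‖z‖ ^ 2)⁻¹)) ^ 2 := by
        rw [hQ]
        simp only
        rw [Set.indicator_of_mem (Set.mem_Ioi.2 hz2)]
        have : ‖z‖ ≠ 0 := by linarith
        field_simp
      linarith [hP0 z]
  have hmain : (∫ z in Metric.ball (0 : EuclideanSpace ℝ (Fin 3)) ε,
      ‖gradient (heps ε w) z‖ ^ 2) ≤
      (2304 * V ^ 3 * C ^ 7 + 52 * C ^ 2 * V / c + 1) * μ ^ (2 - β) := by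
    rw [hμβ, ← integral_indicator measurableSet_ball]
    calc _ ≤ ∫ z, (P z + Q z + S z) := by
          refine integral_mono_of_nonneg
            (.of_forall fun z => Set.indicator_nonneg (fun _ _ => by positivity) z)
            ((hPi.add hQi).add hSi) (.of_forall fun z => ?_)
          by_cases hz : z ∈ Metric.ball (0 : EuclideanSpace ℝ (Fin 3)) ε
          · simpa only [Set.indicator_of_mem hz] using hpt z hz
          · simp only [Set.indicator_of_notMem hz]
            exact add_nonneg (add_nonneg (hP0 z) (hQ0 z)) (hS0 z)
      _ = (2 * ϱ) ^ 3 * V * (2 * a ^ 2) + 2 * (4 * (C * μ)) ^ 2 * (3 * V * (2 * ϱ)⁻¹) +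
          ε ^ 3 * V * (2 * B ^ 2) := by
          rw [integral_add (f := fun z => P z + Q z) (hPi.add hQi) hSi, integral_add hPi hQi, hQ,
            integral_const_mul, hI4v,
            hP, hS, integral_indicator_const _ measurableSet_closedBall,
            integral_indicator_const _ measurableSet_closedBall,
            Measure.addHaar_real_closedBall _ _ (by positivity),
            Measure.addHaar_real_closedBall _ _ hε.1.le]
          simp [hVdef]
      _ ≤ _ := energy_bound_le hc hC hV hμ0 ht0 hϱ1 hϱ2 hϱε
  refine ⟨hC1, hmain, (Real.sqrt_le_sqrt hmain).trans_eq ?_⟩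
  rw [Real.sqrt_mul (by positivity), Real.sqrt_eq_rpow (μ ^ (2 - β)), ← Real.rpow_mul hμ0.le]
  congr 2
  ring
end

section
/- There is an absolute constant C > 0 with the following property. Let 0 < σ₁ < σ₂ ≤ 1 and Λ > 0, for i = 1, 2 let ω_i be an admissible 2D density of range σ_i and mass scale Λ with ∫_{ℝ²} ω₁ = ∫_{ℝ²} ω₂, and define h(x) = (1/2π) ∫_{ℝ²} ln|x − ξ| (ω₁(ξ) − ω₂(ξ)) dξ. Then ‖h‖_{L²(ℝ²)} ≤ C Λ σ₂ (1 + ln(1/σ₂)). -/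
open MeasureTheory

/-- An admissible 2D density of range `σ` and mass scale `Λ`: a measurable, nonnegative,
radial function on `ℝ²` supported in the ball of radius `σ`, bounded by `Λ σ⁻²`, and of
total mass at most `Λ`. -/
def IsAdmissibleDensity (σ Λ : ℝ) (ω : EuclideanSpace ℝ (Fin 2) → ℝ) : Prop :=
  Measurable ω ∧ (∀ x, 0 ≤ ω x) ∧ (∀ x y, ‖x‖ = ‖y‖ → ω x = ω y) ∧
    (∀ x, ω x ≠ 0 → ‖x‖ ≤ σ) ∧ (∀ x, ω x ≤ Λ / σ ^ 2) ∧ (∫ x, ω x) ≤ Λ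

/-- The 2D logarithmic potential `h(x) = (1/2π) ∫ ln|x−ξ| (ω₁(ξ) − ω₂(ξ)) dξ`. -/
noncomputable def logPotential (ω₁ ω₂ : EuclideanSpace ℝ (Fin 2) → ℝ)
    (x : EuclideanSpace ℝ (Fin 2)) : ℝ :=
  (1 / (2 * Real.pi)) * ∫ ξ, Real.log ‖x - ξ‖ * (ω₁ ξ - ω₂ ξ)

open scoped ENNReal

/-- The mean value property for `log ‖z - · * w‖` on the unit circle. -/
lemma intervalIntegral_log_norm_sub_circleMap_mul {z w : ℂ} (h : ‖w‖ < ‖z‖) :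
    ∫ θ in (0 : ℝ)..2 * Real.pi, Real.log ‖z - circleMap 0 1 θ * w‖
      = 2 * Real.pi * Real.log ‖z‖ := by
  have key : Real.circleAverage (fun u : ℂ ↦ Real.log ‖z - u * w‖) 0 1 = Real.log ‖z‖ := by
    rw [InnerProductSpace.HarmonicOnNhd.circleAverage_eq]
    · simp
    · intro x hx
      apply AnalyticAt.harmonicAt_log_norm (by fun_prop)
      rw [sub_ne_zero]
      rintro rfl
      simp only [abs_one, Metric.mem_closedBall, dist_zero_right] at hx
      rw [norm_mul] at h
      nlinarith [norm_nonneg w]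
  rw [Real.circleAverage_def, smul_eq_mul] at key
  rw [← key, mul_inv_cancel_left₀ (by positivity)]

/-- **Newton's theorem**: outside its support, a radial density has the same logarithmic
potential as the point mass at the origin. -/
lemma integral_log_norm_sub_mul_of_radial {v : ℂ → ℝ} {σ : ℝ} {z : ℂ} (hv : Measurable v)
    (hint : Integrable v) (hrad : ∀ x y, ‖x‖ = ‖y‖ → v x = v y)
    (hsupp : ∀ x, v x ≠ 0 → ‖x‖ ≤ σ) (hz : σ < ‖z‖) :
    ∫ w, Real.log ‖z - w‖ * v w = Real.log ‖z‖ * ∫ w, v w := by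
  set F : ℝ → ℂ → ℝ := fun θ w ↦ Real.log ‖z - circleMap 0 1 θ * w‖ * v w with hF
  have hrot (θ : ℝ) : ∫ w, F θ w = ∫ w, Real.log ‖z - w‖ * v w := by
    have hmp := (rotation (Circle.exp θ)).measurePreserving
    have := hmp.integral_comp (rotation (Circle.exp θ)).toHomeomorph.measurableEmbedding
      (fun w ↦ Real.log ‖z - w‖ * v w)
    rw [← this]
    refine integral_congr_ae (.of_forall fun w ↦ ?_)
    simp only [hF]
    have h1 : v (rotation (Circle.exp θ) w) = v w := hrad _ _ (LinearIsometryEquiv.norm_map _ _)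
    rw [h1, rotation_apply, Circle.coe_exp]
    simp [circleMap]
  have : IsFiniteMeasure (volume.restrict (Set.uIoc 0 (2 * Real.pi))) := by
    rw [Set.uIoc]; infer_instance
  have hFint : Integrable (Function.uncurry F)
      ((volume.restrict (Set.uIoc 0 (2 * Real.pi))).prod volume) := by
    refine Integrable.mono' (g := fun p ↦
      (|Real.log (‖z‖ - σ)| + |Real.log (‖z‖ + σ)|) * ‖v p.2‖)
      ((hint.norm.comp_snd _).const_mul _) ?_ (.of_forall fun p ↦ ?_)
    · have : Measurable (Function.uncurry F) := by
        simp only [hF, Function.uncurry_def, circleMap]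
        fun_prop
      exact this.aestronglyMeasurable
    · rcases p with ⟨θ, w⟩
      simp only [Function.uncurry, hF, norm_mul]
      by_cases h0 : v w = 0
      · simp [h0]
      gcongr
      have hw := hsupp w h0
      have hn : ‖circleMap 0 1 θ * w‖ = ‖w‖ := by simp
      have lo := norm_sub_norm_le z (circleMap 0 1 θ * w)
      have hi := norm_sub_le z (circleMap 0 1 θ * w)
      rw [hn] at lo hi
      have l1 := Real.log_le_log (x := ‖z‖ - σ) (y := ‖z - circleMap 0 1 θ * w‖)
        (by linarith) (by linarith)
      have l2 := Real.log_le_log (x := ‖z - circleMap 0 1 θ * w‖) (y := ‖z‖ + σ)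
        (by linarith) (by linarith)
      rw [Real.norm_eq_abs, abs_le]
      constructor
      · linarith [neg_abs_le (Real.log (‖z‖ - σ)), abs_nonneg (Real.log (‖z‖ + σ))]
      · linarith [le_abs_self (Real.log (‖z‖ + σ)), abs_nonneg (Real.log (‖z‖ - σ))]
  have hswap := intervalIntegral_integral_swap hFint
  simp only [hrot, intervalIntegral.integral_const, smul_eq_mul, sub_zero] at hswap
  have hinner (w : ℂ) : ∫ θ in (0 : ℝ)..2 * Real.pi, F θ w
      = 2 * Real.pi * Real.log ‖z‖ * v w := by
    simp only [hF, intervalIntegral.integral_mul_const]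
    by_cases h0 : v w = 0
    · simp [h0]
    rw [intervalIntegral_log_norm_sub_circleMap_mul ((hsupp w h0).trans_lt hz)]
  simp only [hinner, integral_const_mul, mul_assoc] at hswap
  have := Real.pi_pos
  exact mul_left_cancel₀ this.ne' (mul_left_cancel₀ two_ne_zero hswap)

/-- Newton's theorem on `EuclideanSpace ℝ (Fin 2)`. -/
lemma EuclideanSpace.integral_log_norm_sub_mul_of_radial {v : EuclideanSpace ℝ (Fin 2) → ℝ}
    {σ : ℝ} {x : EuclideanSpace ℝ (Fin 2)} (hv : Measurable v)
    (hint : Integrable v) (hrad : ∀ x y, ‖x‖ = ‖y‖ → v x = v y)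
    (hsupp : ∀ x, v x ≠ 0 → ‖x‖ ≤ σ) (hx : σ < ‖x‖) :
    ∫ ξ, Real.log ‖x - ξ‖ * v ξ = Real.log ‖x‖ * ∫ ξ, v ξ := by
  set e := Complex.orthonormalBasisOneI.repr
  have hmp : MeasurePreserving e := e.measurePreserving
  have hemb : MeasurableEmbedding e := e.toHomeomorph.measurableEmbedding
  obtain ⟨z, rfl⟩ := e.surjective x
  have := _root_.integral_log_norm_sub_mul_of_radial (v := v ∘ e) (σ := σ) (z := z)
    (hv.comp hmp.measurable) ((hmp.integrable_comp_emb hemb).2 hint)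
    (fun a b hab ↦ hrad _ _ (by simpa using hab)) (fun a ha ↦ by simpa using hsupp _ ha)
    (by simpa using hx)
  rw [← hmp.integral_comp hemb, ← hmp.integral_comp hemb, LinearIsometryEquiv.norm_map]
  simpa [← map_sub] using this

lemma mul_log_sq_le {s : ℝ} (h0 : 0 < s) (h3 : s < 3) : s * Real.log s ^ 2 ≤ 12 := by
  rcases le_or_gt s 1 with h1 | h1
  · have h := Real.abs_log_mul_self_rpow_lt s (1 / 2) h0 h1 (by norm_num)
    rw [← Real.sqrt_eq_rpow] at h
    have h2 := sq_le_sq' (neg_le_of_abs_le h.le) (le_of_abs_le h.le)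
    rw [mul_pow, Real.sq_sqrt h0.le] at h2
    linarith
  · have hl := Real.log_le_sub_one_of_pos h0
    have hp := Real.log_pos h1
    nlinarith [mul_pos h0 hp]

lemma mul_log_sq_le_of_lt_three_mul {ρ y : ℝ} (hρ : 0 < ρ) (hρ1 : ρ ≤ 1) (h0 : 0 < y)
    (h3 : y < 3 * ρ) : y * Real.log y ^ 2 ≤ 24 * ρ * (1 + Real.log (1 / ρ)) ^ 2 := by
  have hs := mul_log_sq_le (s := y / ρ) (by positivity) (by rwa [div_lt_iff₀ hρ])
  rw [Real.log_div h0.ne' hρ.ne', div_mul_eq_mul_div, div_le_iff₀ hρ] at hs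
  have hl : 0 ≤ Real.log (1 / ρ) := Real.log_nonneg (by rwa [le_div_iff₀ hρ, one_mul])
  have he : Real.log ρ = -Real.log (1 / ρ) := by simp
  rw [he] at hs
  generalize Real.log (1 / ρ) = l at *
  generalize Real.log y = a at *
  have : a ^ 2 ≤ 2 * l ^ 2 + 2 * (a - -l) ^ 2 := by nlinarith [sq_nonneg (a + 2 * l)]
  calc y * a ^ 2 ≤ y * (2 * l ^ 2 + 2 * (a - -l) ^ 2) := by gcongr
    _ = 2 * (y * l ^ 2) + 2 * (y * (a - -l) ^ 2) := by ring
    _ ≤ 2 * (3 * ρ * l ^ 2) + 2 * (12 * ρ) := by gcongr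
    _ ≤ _ := by nlinarith [mul_nonneg hρ.le hl, mul_nonneg hρ.le (sq_nonneg l)]

/-- The square of the logarithm has integral `O(ρ² (1 + log (1/ρ))²)` over a disc of
radius `3ρ`. -/
lemma setLIntegral_log_norm_sq_le {ρ : ℝ} (hρ : 0 < ρ) (hρ1 : ρ ≤ 1) :
    ∫⁻ y in Metric.ball (0 : EuclideanSpace ℝ (Fin 2)) (3 * ρ), ENNReal.ofReal (Real.log ‖y‖ ^ 2)
      ≤ ENNReal.ofReal (144 * Real.pi * (ρ * (1 + Real.log (1 / ρ))) ^ 2) := by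
  have hdim : Module.finrank ℝ (EuclideanSpace ℝ (Fin 2)) = 2 := by simp
  have hbound : ∀ y ∈ Set.Ioo (0 : ℝ) (3 * ρ),
      y * Real.log y ^ 2 ≤ 24 * ρ * (1 + Real.log (1 / ρ)) ^ 2 :=
    fun y hy ↦ mul_log_sq_le_of_lt_three_mul hρ hρ1 hy.1 hy.2
  have hon : IntegrableOn (fun y : ℝ ↦ y * Real.log y ^ 2) (Set.Ioo 0 (3 * ρ)) := by
    refine Integrable.mono' (g := fun _ ↦ 24 * ρ * (1 + Real.log (1 / ρ)) ^ 2)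
      (integrableOn_const measure_Ioo_lt_top.ne) (by fun_prop) ?_
    refine (ae_restrict_iff' measurableSet_Ioo).2 (.of_forall fun y hy ↦ ?_)
    rw [Real.norm_of_nonneg (mul_nonneg hy.1.le (sq_nonneg _))]
    exact hbound y hy
  have hint : IntegrableOn (fun y : EuclideanSpace ℝ (Fin 2) ↦ Real.log ‖y‖ ^ 2)
      (Metric.ball 0 (3 * ρ)) :=
    (integrableOn_fun_norm_addHaar volume (f := fun y ↦ Real.log y ^ 2)).2 (by simpa using hon)
  rw [← ofReal_integral_eq_lintegral_ofReal hint (.of_forall fun _ ↦ sq_nonneg _)]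
  apply ENNReal.ofReal_le_ofReal
  have hpolar : ∫ y in Metric.ball (0 : EuclideanSpace ℝ (Fin 2)) (3 * ρ), Real.log ‖y‖ ^ 2
      = 2 * (Real.pi * ∫ y in Set.Ioo 0 (3 * ρ), y * Real.log y ^ 2) := by
    have h := integral_fun_norm_addHaar (volume : Measure (EuclideanSpace ℝ (Fin 2)))
      ((Set.Iio (3 * ρ)).indicator fun y ↦ Real.log y ^ 2)
    have hl : (fun x : EuclideanSpace ℝ (Fin 2) ↦
        (Set.Iio (3 * ρ)).indicator (fun y ↦ Real.log y ^ 2) ‖x‖)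
        = (Metric.ball 0 (3 * ρ)).indicator fun x ↦ Real.log ‖x‖ ^ 2 := by
      ext x
      simp [Set.indicator]
    have hr : (fun y : ℝ ↦ y ^ (2 - 1) •
        (Set.Iio (3 * ρ)).indicator (fun y ↦ Real.log y ^ 2) y)
        = (Set.Iio (3 * ρ)).indicator fun y ↦ y * Real.log y ^ 2 := by
      ext y
      simp [Set.indicator]
    have hvol : volume.real (Metric.ball (0 : EuclideanSpace ℝ (Fin 2)) 1) = Real.pi := by
      simp [Measure.real, Real.pi_pos.le]
    rw [hdim, hl, hr, hvol, integral_indicator measurableSet_ball,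
      setIntegral_indicator measurableSet_Iio, Set.Ioi_inter_Iio] at h
    simpa [mul_assoc] using h
  have hI : ∫ y in Set.Ioo 0 (3 * ρ), y * Real.log y ^ 2
      ≤ 24 * ρ * (1 + Real.log (1 / ρ)) ^ 2 * (3 * ρ) := by
    refine (setIntegral_mono_on hon (integrableOn_const measure_Ioo_lt_top.ne) measurableSet_Ioo
      hbound).trans_eq ?_
    rw [setIntegral_const, smul_eq_mul, mul_comm]
    simp [hρ.le]
  rw [hpolar]
  calc _ ≤ 2 * (Real.pi * (24 * ρ * (1 + Real.log (1 / ρ)) ^ 2 * (3 * ρ))) := by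
        gcongr
    _ = _ := by ring

/-- The Cauchy–Schwarz inequality with a weight. -/
lemma sq_lintegral_mul_le {α : Type*} [MeasurableSpace α] (μ : Measure α) {f g : α → ℝ≥0∞}
    (hf : Measurable f) (hg : Measurable g) :
    (∫⁻ a, g a * f a ∂μ) ^ 2 ≤ (∫⁻ a, g a ∂μ) * ∫⁻ a, g a * f a ^ 2 ∂μ := by
  have h := ENNReal.lintegral_mul_le_Lp_mul_Lq (μ.withDensity g) Real.HolderConjugate.two_two
    (f := 1) (g := f) (by fun_prop) hf.aemeasurable
  simp only [one_mul, Pi.one_apply, ENNReal.rpow_two] at h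
  rw [lintegral_withDensity_eq_lintegral_mul _ hg hf,
    lintegral_withDensity_eq_lintegral_mul _ hg measurable_const,
    lintegral_withDensity_eq_lintegral_mul _ hg (hf.pow_const 2),
    ← ENNReal.mul_rpow_of_nonneg _ _ (by norm_num)] at h
  have h2 := pow_le_pow_left' h 2
  rw [← ENNReal.rpow_two, ← ENNReal.rpow_two, ← ENNReal.rpow_mul] at h2
  simpa using h2

/-- An `L²` bound on the disc of radius `ρ` for logarithmic potentials of densities supported
there. -/
lemma setLIntegral_sq_lintegral_log_le {ρ : ℝ} (hρ : 0 < ρ) (hρ1 : ρ ≤ 1)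
    {g : EuclideanSpace ℝ (Fin 2) → ℝ≥0∞} (hg : Measurable g) (hsupp : ∀ x, g x ≠ 0 → ‖x‖ ≤ ρ) :
    ∫⁻ x in Metric.closedBall 0 ρ, (∫⁻ ξ, g ξ * ENNReal.ofReal |Real.log ‖x - ξ‖|) ^ 2
      ≤ (∫⁻ ξ, g ξ) ^ 2 *
        ENNReal.ofReal (144 * Real.pi * (ρ * (1 + Real.log (1 / ρ))) ^ 2) := by
  set K := ENNReal.ofReal (144 * Real.pi * (ρ * (1 + Real.log (1 / ρ))) ^ 2)
  have hsq (x ξ : EuclideanSpace ℝ (Fin 2)) : ENNReal.ofReal |Real.log ‖x - ξ‖| ^ 2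
      = ENNReal.ofReal (Real.log ‖x - ξ‖ ^ 2) := by
    rw [← ENNReal.ofReal_pow (abs_nonneg _), sq_abs]
  have hinner (ξ : EuclideanSpace ℝ (Fin 2)) (hξ : ‖ξ‖ ≤ ρ) :
      ∫⁻ x in Metric.closedBall 0 ρ, ENNReal.ofReal (Real.log ‖x - ξ‖ ^ 2) ≤ K := by
    refine le_trans ?_ (setLIntegral_log_norm_sq_le hρ hρ1)
    rw [← lintegral_indicator measurableSet_closedBall, ← lintegral_indicator measurableSet_ball,
      ← lintegral_sub_right_eq_self (Set.indicator (Metric.ball 0 (3 * ρ)) _) ξ]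
    refine lintegral_mono fun x ↦ ?_
    by_cases hx : x ∈ Metric.closedBall (0 : EuclideanSpace ℝ (Fin 2)) ρ
    · rw [Set.indicator_of_mem hx, Set.indicator_of_mem]
      rw [mem_closedBall_zero_iff] at hx
      rw [mem_ball_zero_iff]
      linarith [norm_sub_le x ξ]
    · simp [Set.indicator_of_notMem hx]
  calc _ ≤ ∫⁻ x in Metric.closedBall 0 ρ,
          (∫⁻ ξ, g ξ) * ∫⁻ ξ, g ξ * ENNReal.ofReal (Real.log ‖x - ξ‖ ^ 2) := by
        refine lintegral_mono fun x ↦ ?_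
        simp only [← hsq]
        exact sq_lintegral_mul_le _ (by fun_prop) hg
    _ = (∫⁻ ξ, g ξ) * ∫⁻ x in Metric.closedBall 0 ρ,
          ∫⁻ ξ, g ξ * ENNReal.ofReal (Real.log ‖x - ξ‖ ^ 2) := by
        refine lintegral_const_mul _ ?_
        refine Measurable.lintegral_prod_right' (f := fun p : EuclideanSpace ℝ (Fin 2) ×
          EuclideanSpace ℝ (Fin 2) ↦ g p.2 * ENNReal.ofReal (Real.log ‖p.1 - p.2‖ ^ 2)) ?_
        fun_prop
    _ = (∫⁻ ξ, g ξ) * ∫⁻ ξ, g ξ *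
          ∫⁻ x in Metric.closedBall 0 ρ, ENNReal.ofReal (Real.log ‖x - ξ‖ ^ 2) := by
        rw [lintegral_lintegral_swap]
        · congr 1
          refine lintegral_congr fun ξ ↦ lintegral_const_mul _ (by fun_prop)
        · simp only [Function.uncurry_def]
          fun_prop
    _ ≤ (∫⁻ ξ, g ξ) * ∫⁻ ξ, g ξ * K := by
        refine mul_le_mul_right (lintegral_mono fun ξ ↦ ?_) _
        by_cases h0 : g ξ = 0
        · simp [h0]
        refine mul_le_mul_right ?_ _
        exact hinner ξ (hsupp ξ h0)
    _ = _ := by rw [lintegral_mul_const _ hg, sq, mul_assoc]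

lemma IsAdmissibleDensity.integrable {σ Λ : ℝ} {ω : EuclideanSpace ℝ (Fin 2) → ℝ}
    (h : IsAdmissibleDensity σ Λ ω) : Integrable ω := by
  obtain ⟨hm, h0, -, hs, hb, -⟩ := h
  have hon : IntegrableOn ω (Metric.closedBall 0 σ) := by
    refine Integrable.mono' (g := fun _ ↦ Λ / σ ^ 2) (integrableOn_const measure_closedBall_lt_top.ne)
      hm.aestronglyMeasurable (.of_forall fun x ↦ ?_)
    rw [Real.norm_of_nonneg (h0 x)]
    exact hb x
  exact (integrableOn_iff_integrable_of_support_subset fun x hx ↦ by simpa using hs x hx).1 hon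

lemma logPotential_eq_zero {σ₁ σ₂ Λ : ℝ} {ω₁ ω₂ : EuclideanSpace ℝ (Fin 2) → ℝ} (hσ : σ₁ ≤ σ₂)
    (h₁ : IsAdmissibleDensity σ₁ Λ ω₁) (h₂ : IsAdmissibleDensity σ₂ Λ ω₂)
    (heq : ∫ x, ω₁ x = ∫ x, ω₂ x) {x : EuclideanSpace ℝ (Fin 2)} (hx : σ₂ < ‖x‖) :
    logPotential ω₁ ω₂ x = 0 := by
  have key := EuclideanSpace.integral_log_norm_sub_mul_of_radial (v := fun ξ ↦ ω₁ ξ - ω₂ ξ)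
    (h₁.1.sub h₂.1) (h₁.integrable.sub h₂.integrable)
    (fun a b hab ↦ by rw [h₁.2.2.1 a b hab, h₂.2.2.1 a b hab])
    (fun a ha ↦ by
      by_cases h : ω₁ a = 0
      · exact h₂.2.2.2.1 a fun h' ↦ ha (by simp [h, h'])
      · exact (h₁.2.2.2.1 a h).trans hσ) hx
  rw [logPotential, key, integral_sub h₁.integrable h₂.integrable, heq]
  simp

lemma enorm_logPotential_le {ω₁ ω₂ : EuclideanSpace ℝ (Fin 2) → ℝ} (h₁ : ∀ x, 0 ≤ ω₁ x)
    (h₂ : ∀ x, 0 ≤ ω₂ x) (x : EuclideanSpace ℝ (Fin 2)) :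
    ‖logPotential ω₁ ω₂ x‖ₑ ≤ ENNReal.ofReal (1 / (2 * Real.pi)) *
      ∫⁻ ξ, ENNReal.ofReal (ω₁ ξ + ω₂ ξ) * ENNReal.ofReal |Real.log ‖x - ξ‖| := by
  rw [logPotential, enorm_mul, Real.enorm_of_nonneg (by positivity)]
  gcongr
  refine (enorm_integral_le_lintegral_enorm _).trans (lintegral_mono fun ξ ↦ ?_)
  rw [enorm_mul, mul_comm, ← Real.enorm_abs (Real.log _), Real.enorm_of_nonneg (abs_nonneg _),
    ← Real.enorm_abs, Real.enorm_of_nonneg (abs_nonneg _)]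
  gcongr
  rw [abs_le]
  constructor <;> linarith [h₁ ξ, h₂ ξ]

theorem stmt15 :
    ∃ C > (0 : ℝ), ∀ σ₁ σ₂ Λ : ℝ, 0 < σ₁ → σ₁ < σ₂ → σ₂ ≤ 1 → 0 < Λ →
      ∀ ω₁ ω₂ : EuclideanSpace ℝ (Fin 2) → ℝ,
        IsAdmissibleDensity σ₁ Λ ω₁ → IsAdmissibleDensity σ₂ Λ ω₂ →
        (∫ x, ω₁ x) = (∫ x, ω₂ x) →
        Real.sqrt (∫ x, logPotential ω₁ ω₂ x ^ 2) ≤ C * Λ * σ₂ * (1 + Real.log (1 / σ₂)) := by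
  refine ⟨12, by norm_num, fun σ₁ σ₂ Λ hσ₁ hσ hσ₂ hΛ ω₁ ω₂ h₁ h₂ heq ↦ ?_⟩
  have hσ₂' : 0 < σ₂ := hσ₁.trans hσ
  have hl : 0 ≤ Real.log (1 / σ₂) := Real.log_nonneg (by rwa [le_div_iff₀ hσ₂', one_mul])
  set R := σ₂ * (1 + Real.log (1 / σ₂)) with hR
  have hR0 : 0 ≤ R := by positivity
  rw [mul_assoc, ← hR]
  refine Real.sqrt_le_iff.2 ⟨by positivity, ?_⟩
  by_cases hint : Integrable fun x ↦ logPotential ω₁ ω₂ x ^ 2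
  swap
  · rw [integral_undef hint]
    positivity
  rw [← ENNReal.ofReal_le_ofReal_iff (by positivity),
    ofReal_integral_eq_lintegral_ofReal hint (.of_forall fun _ ↦ sq_nonneg _)]
  have hmass : ∫⁻ ξ, ENNReal.ofReal (ω₁ ξ + ω₂ ξ) ≤ ENNReal.ofReal (2 * Λ) := by
    rw [← ofReal_integral_eq_lintegral_ofReal (f := fun ξ ↦ ω₁ ξ + ω₂ ξ)
      (h₁.integrable.add h₂.integrable)
      (.of_forall fun x ↦ add_nonneg (h₁.2.1 x) (h₂.2.1 x)),
      integral_add h₁.integrable h₂.integrable]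
    apply ENNReal.ofReal_le_ofReal
    linarith [h₁.2.2.2.2.2, h₂.2.2.2.2.2]
  set g : EuclideanSpace ℝ (Fin 2) → ℝ≥0∞ := fun ξ ↦ ENNReal.ofReal (ω₁ ξ + ω₂ ξ) with hg
  have hgm : Measurable g := (h₁.1.add h₂.1).ennreal_ofReal
  have hgs (x) (hx : g x ≠ 0) : ‖x‖ ≤ σ₂ := by
    by_cases h : ω₁ x = 0
    · exact h₂.2.2.2.1 x fun h' ↦ hx (by simp [hg, h, h'])
    · exact (h₁.2.2.2.1 x h).trans hσ.le
  have hpi := Real.pi_gt_three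
  calc ∫⁻ x, ENNReal.ofReal (logPotential ω₁ ω₂ x ^ 2)
      = ∫⁻ x in Metric.closedBall 0 σ₂, ENNReal.ofReal (logPotential ω₁ ω₂ x ^ 2) := by
        rw [← lintegral_indicator measurableSet_closedBall]
        refine lintegral_congr fun x ↦ ?_
        by_cases hx : x ∈ Metric.closedBall (0 : EuclideanSpace ℝ (Fin 2)) σ₂
        · rw [Set.indicator_of_mem hx]
        · rw [Set.indicator_of_notMem hx, logPotential_eq_zero hσ.le h₁ h₂ heq (by simpa using hx)]
          simp
    _ ≤ ∫⁻ x in Metric.closedBall 0 σ₂, ENNReal.ofReal (1 / (2 * Real.pi)) ^ 2 *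
          (∫⁻ ξ, g ξ * ENNReal.ofReal |Real.log ‖x - ξ‖|) ^ 2 := by
        refine lintegral_mono fun x ↦ ?_
        rw [← mul_pow, ← sq_abs, ENNReal.ofReal_pow (abs_nonneg _),
          ← Real.enorm_of_nonneg (abs_nonneg _), Real.enorm_abs]
        gcongr
        exact enorm_logPotential_le h₁.2.1 h₂.2.1 x
    _ = ENNReal.ofReal (1 / (2 * Real.pi)) ^ 2 * ∫⁻ x in Metric.closedBall 0 σ₂,
          (∫⁻ ξ, g ξ * ENNReal.ofReal |Real.log ‖x - ξ‖|) ^ 2 :=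
        lintegral_const_mul' _ _ (by simp)
    _ ≤ ENNReal.ofReal (1 / (2 * Real.pi)) ^ 2 *
          (ENNReal.ofReal (2 * Λ) ^ 2 * ENNReal.ofReal (144 * Real.pi * R ^ 2)) := by
        gcongr
        refine (setLIntegral_sq_lintegral_log_le hσ₂' hσ₂ hgm hgs).trans ?_
        gcongr
    _ = ENNReal.ofReal ((1 / (2 * Real.pi)) ^ 2 * ((2 * Λ) ^ 2 * (144 * Real.pi * R ^ 2))) := by
        rw [← ENNReal.ofReal_pow (by positivity), ← ENNReal.ofReal_pow (by positivity),
          ← ENNReal.ofReal_mul (by positivity), ← ENNReal.ofReal_mul (by positivity)]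
    _ ≤ ENNReal.ofReal ((12 * Λ * R) ^ 2) := by
        apply ENNReal.ofReal_le_ofReal
        have : (1 / (2 * Real.pi)) ^ 2 * ((2 * Λ) ^ 2 * (144 * Real.pi * R ^ 2))
            = (12 * Λ * R) ^ 2 / Real.pi := by
          field_simp
          ring
        rw [this]
        exact div_le_self (sq_nonneg _) (by linarith)
end
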